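/- Let d ≥ 1, N ≥ 2, and assume Assumptions (U), (G1), (G2) together with the normalization ∑_{i=1}^N U(qᵢ) + ∑_{1≤i<j≤N} G(qᵢ−qⱼ) ≥ 1 for all q ∈ D. There exists ε₀ ∈ (0,1) such that for every ε ∈ (0,ε₀) there exist constants A₁, A₂, κ_N > 0 such that the function V_N(q,p) = A₁·H_N(q,p)³ + ε·H_N(q,p)·⟨q,p⟩ − A₂ε² ∑_{1≤i<j≤N} ⟨qᵢ−qⱼ, pᵢ−pⱼ⟩/|qᵢ−qⱼ|^{β₁−1} + κ_N satisfies V_N ≥ 1 on X, and for every integer n ≥ 1 there exist constants c_n, C_n > 0 such that L_N(V_Nⁿ)(q,p) ≤ −c_n·V_N(q,p)^{n−1/3} + C_n for all (q,p) ∈ X. Here ⟨q,p⟩ = ∑_{i=1}^N ⟨qᵢ,pᵢ⟩. (Lemma 3.2) -/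

import Mathlib

open scoped RealInnerProductSpace

/-- The `N`-particle generator `L_N` of the relativistic Langevin dynamics (2.2):
`L_Nφ = ∑ᵢ ⟨pᵢ/√(1+ε|pᵢ|²), ∇_{qᵢ}φ⟩
      + ∑ᵢ ⟨−pᵢ/√(1+ε|pᵢ|²) − ∇U(qᵢ) − ∑_{j≠i}∇G(qᵢ−qⱼ), ∇_{pᵢ}φ⟩ + ∑ᵢ Δ_{pᵢ}φ`. -/
noncomputable def LN {d N : ℕ} (ε : ℝ) (U G : EuclideanSpace ℝ (Fin d) → ℝ)
    (φ : (Fin N → EuclideanSpace ℝ (Fin d)) → (Fin N → EuclideanSpace ℝ (Fin d)) → ℝ)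
    (q p : Fin N → EuclideanSpace ℝ (Fin d)) : ℝ :=
  (∑ i : Fin N,
      ⟪(Real.sqrt (1 + ε * ‖p i‖ ^ 2))⁻¹ • p i,
        gradient (fun x => φ (Function.update q i x) p) (q i)⟫)
    + (∑ i : Fin N,
        ⟪-((Real.sqrt (1 + ε * ‖p i‖ ^ 2))⁻¹ • p i) - gradient U (q i)
            - ∑ j ∈ Finset.univ.filter (fun j => j ≠ i), gradient G (q i - q j),
          gradient (fun x => φ q (Function.update p i x)) (p i)⟫)
    + ∑ i : Fin N, ∑ α : Fin d,
        fderiv ℝ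
          (fun x => fderiv ℝ (fun y => φ q (Function.update p i y)) x
            (EuclideanSpace.single α 1))
          (p i) (EuclideanSpace.single α 1)

/-- The `N`-particle Hamiltonian
`H_N(q,p) = ε∑ᵢU(qᵢ) + ε∑_{i<j}G(qᵢ−qⱼ) + ∑ᵢ√(1+ε|pᵢ|²)`. -/
noncomputable def HN {d N : ℕ} (ε : ℝ) (U G : EuclideanSpace ℝ (Fin d) → ℝ)
    (q p : Fin N → EuclideanSpace ℝ (Fin d)) : ℝ :=
  ε * ∑ i, U (q i)
    + ε * ∑ i : Fin N, ∑ j ∈ Finset.univ.filter (fun j => i < j), G (q i - q j)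
    + ∑ i, Real.sqrt (1 + ε * ‖p i‖ ^ 2)

/-- The `N`-particle Lyapunov candidate
`V_N(q,p) = A₁H_N³ + εH_N⟨q,p⟩ − A₂ε²∑_{i<j}⟨qᵢ−qⱼ,pᵢ−pⱼ⟩/|qᵢ−qⱼ|^{β₁−1} + κ_N`. -/
noncomputable def VN {d N : ℕ} (ε β₁ A₁ A₂ κ : ℝ)
    (U G : EuclideanSpace ℝ (Fin d) → ℝ)
    (q p : Fin N → EuclideanSpace ℝ (Fin d)) : ℝ :=
  A₁ * (HN ε U G q p) ^ 3 + ε * HN ε U G q p * (∑ i, ⟪q i, p i⟫)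
    - A₂ * ε ^ 2 *
        ∑ i : Fin N, ∑ j ∈ Finset.univ.filter (fun j => i < j),
          ⟪q i - q j, p i - p j⟫ / ‖q i - q j‖ ^ (β₁ - 1)
    + κ

namespace RelLangevin

section Calculus

variable {P : Type*} [NormedAddCommGroup P] [NormedSpace ℝ P]

/-- The second derivative of `f` at `p` in the direction `u`. -/
noncomputable def secondDeriv (f : P → ℝ) (p u : P) : ℝ :=
  fderiv ℝ (fun x => fderiv ℝ f x u) p u

lemma differentiable_fderiv_apply {f : P → ℝ} (hf : ContDiff ℝ 2 f) (u : P) :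
    Differentiable ℝ (fun x => fderiv ℝ f x u) := by
  have h : ContDiff ℝ 1 (fderiv ℝ f) := hf.fderiv_right (by norm_num)
  exact (h.differentiable one_ne_zero).clm_apply (differentiable_const u)

lemma secondDeriv_const (c : ℝ) (p u : P) : secondDeriv (fun _ => c) p u = 0 := by
  simp [secondDeriv]

lemma secondDeriv_add {f g : P → ℝ} (hf : ContDiff ℝ 2 f) (hg : ContDiff ℝ 2 g) (p u : P) :
    secondDeriv (fun x => f x + g x) p u = secondDeriv f p u + secondDeriv g p u := by
  have h : (fun x => fderiv ℝ (fun x => f x + g x) x u)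
      = fun x => fderiv ℝ f x u + fderiv ℝ g x u := by
    funext x
    rw [fderiv_fun_add (hf.differentiable two_ne_zero x) (hg.differentiable two_ne_zero x)]
    rfl
  unfold secondDeriv
  rw [h, fderiv_fun_add (differentiable_fderiv_apply hf u p) (differentiable_fderiv_apply hg u p)]
  rfl

lemma secondDeriv_mul {f g : P → ℝ} (hf : ContDiff ℝ 2 f) (hg : ContDiff ℝ 2 g) (p u : P) :
    secondDeriv (fun x => f x * g x) p u
      = f p * secondDeriv g p u + g p * secondDeriv f p u
        + 2 * (fderiv ℝ f p u * fderiv ℝ g p u) := by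
  have hf1 := hf.differentiable two_ne_zero
  have hg1 := hg.differentiable two_ne_zero
  have hf2 := differentiable_fderiv_apply hf u
  have hg2 := differentiable_fderiv_apply hg u
  have h : (fun x => fderiv ℝ (fun x => f x * g x) x u)
      = fun x => f x * fderiv ℝ g x u + g x * fderiv ℝ f x u := by
    funext x
    rw [fderiv_fun_mul (hf1 x) (hg1 x)]
    simp
  unfold secondDeriv
  rw [h, fderiv_fun_add ((hf1 p).fun_mul (hg2 p)) ((hg1 p).fun_mul (hf2 p)),
    fderiv_fun_mul (hf1 p) (hg2 p), fderiv_fun_mul (hg1 p) (hf2 p)]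
  simp
  ring

end Calculus

section Generator

variable {d N : ℕ}

/-- The coordinate directions in the space of `N` momenta. -/
noncomputable def dir (i : Fin N) (α : Fin d) : Fin N → EuclideanSpace ℝ (Fin d) :=
  Pi.single i (EuclideanSpace.single α (1 : ℝ))

/-- The relativistic velocities. -/
noncomputable def vel (ε : ℝ) (p : Fin N → EuclideanSpace ℝ (Fin d)) :
    Fin N → EuclideanSpace ℝ (Fin d) :=
  fun i => (Real.sqrt (1 + ε * ‖p i‖ ^ 2))⁻¹ • p i

/-- The total interaction force gradient on each particle. -/
noncomputable def interGrad (G : EuclideanSpace ℝ (Fin d) → ℝ)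
    (q : Fin N → EuclideanSpace ℝ (Fin d)) : Fin N → EuclideanSpace ℝ (Fin d) :=
  fun i => ∑ j ∈ Finset.univ.filter (fun j => j ≠ i), gradient G (q i - q j)

/-- The drift of the momenta. -/
noncomputable def force (ε : ℝ) (U G : EuclideanSpace ℝ (Fin d) → ℝ)
    (q p : Fin N → EuclideanSpace ℝ (Fin d)) : Fin N → EuclideanSpace ℝ (Fin d) :=
  fun i => -(vel ε p i) - gradient U (q i) - interGrad G q i

/-- Regularity at `(q, p)` needed to apply the generator. -/
def Admissible (φ : (Fin N → EuclideanSpace ℝ (Fin d)) → (Fin N → EuclideanSpace ℝ (Fin d)) → ℝ)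
    (q p : Fin N → EuclideanSpace ℝ (Fin d)) : Prop :=
  DifferentiableAt ℝ (fun x => φ x p) q ∧ ContDiff ℝ 2 (φ q)

/-- The carré du champ of the generator. -/
noncomputable def carre
    (φ ψ : (Fin N → EuclideanSpace ℝ (Fin d)) → (Fin N → EuclideanSpace ℝ (Fin d)) → ℝ)
    (q p : Fin N → EuclideanSpace ℝ (Fin d)) : ℝ :=
  ∑ i, ∑ α, fderiv ℝ (φ q) p (dir i α) * fderiv ℝ (ψ q) p (dir i α)

lemma inner_gradient_eq_fderiv (f : EuclideanSpace ℝ (Fin d) → ℝ)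
    (x h : EuclideanSpace ℝ (Fin d)) : ⟪gradient f x, h⟫ = fderiv ℝ f x h := by
  simp [gradient]

lemma fderiv_comp_update {f : (Fin N → EuclideanSpace ℝ (Fin d)) → ℝ}
    (q : Fin N → EuclideanSpace ℝ (Fin d)) (i : Fin N) (x h : EuclideanSpace ℝ (Fin d))
    (hf : DifferentiableAt ℝ f (Function.update q i x)) :
    fderiv ℝ (fun y => f (Function.update q i y)) x h
      = fderiv ℝ f (Function.update q i x) (Pi.single i h) := by
  have h1 := (hf.hasFDerivAt.comp x (hasFDerivAt_update (𝕜 := ℝ) q x)).fderiv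
  have h2 : fderiv ℝ (fun y => f (Function.update q i y)) x = _ := h1
  rw [h2]
  simp only [ContinuousLinearMap.comp_apply]
  congr 1
  funext j
  by_cases hj : j = i
  · subst hj; simp
  · simp [hj]

lemma sum_inner_gradient_update {f : (Fin N → EuclideanSpace ℝ (Fin d)) → ℝ}
    {q : Fin N → EuclideanSpace ℝ (Fin d)} (hf : DifferentiableAt ℝ f q)
    (v : Fin N → EuclideanSpace ℝ (Fin d)) :
    ∑ i, ⟪v i, gradient (fun x => f (Function.update q i x)) (q i)⟫ = fderiv ℝ f q v := by
  have h : ∀ i, ⟪v i, gradient (fun x => f (Function.update q i x)) (q i)⟫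
      = fderiv ℝ f q (Pi.single i (v i)) := by
    intro i
    rw [real_inner_comm, inner_gradient_eq_fderiv, fderiv_comp_update, Function.update_eq_self]
    rwa [Function.update_eq_self]
  simp_rw [h]
  rw [← map_sum, Finset.univ_sum_single]

lemma LN_eq (ε : ℝ) (U G : EuclideanSpace ℝ (Fin d) → ℝ)
    {φ : (Fin N → EuclideanSpace ℝ (Fin d)) → (Fin N → EuclideanSpace ℝ (Fin d)) → ℝ}
    {q p : Fin N → EuclideanSpace ℝ (Fin d)} (h : Admissible φ q p) :
    LN ε U G φ q p = fderiv ℝ (fun x => φ x p) q (vel ε p) + fderiv ℝ (φ q) p (force ε U G q p)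
      + ∑ i, ∑ α, secondDeriv (φ q) p (dir i α) := by
  obtain ⟨hq, hp⟩ := h
  have hp1 := hp.differentiable two_ne_zero
  unfold LN
  congr 1
  · congr 1
    · exact sum_inner_gradient_update hq (vel ε p)
    · exact sum_inner_gradient_update (hp1 p) (force ε U G q p)
  · refine Finset.sum_congr rfl fun i _ => Finset.sum_congr rfl fun α _ => ?_
    have h1 : (fun x => fderiv ℝ (fun y => φ q (Function.update p i y)) x
        (EuclideanSpace.single α 1))
        = fun x => (fun z => fderiv ℝ (φ q) z (dir i α)) (Function.update p i x) := by
      funext x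
      rw [fderiv_comp_update p i x _ (hp1 _)]
      rfl
    rw [h1, fderiv_comp_update (f := fun z => fderiv ℝ (φ q) z (dir i α)) p i _ _
      (differentiable_fderiv_apply hp _ _), Function.update_eq_self]
    rfl

variable {φ ψ : (Fin N → EuclideanSpace ℝ (Fin d)) → (Fin N → EuclideanSpace ℝ (Fin d)) → ℝ}
  {q p : Fin N → EuclideanSpace ℝ (Fin d)}

lemma Admissible.const (c : ℝ) : Admissible (fun _ _ => c) q p :=
  ⟨differentiableAt_const c, contDiff_const⟩

lemma Admissible.add (hφ : Admissible φ q p) (hψ : Admissible ψ q p) :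
    Admissible (fun q p => φ q p + ψ q p) q p :=
  ⟨hφ.1.add hψ.1, hφ.2.add hψ.2⟩

lemma Admissible.mul (hφ : Admissible φ q p) (hψ : Admissible ψ q p) :
    Admissible (fun q p => φ q p * ψ q p) q p :=
  ⟨hφ.1.mul hψ.1, hφ.2.mul hψ.2⟩

lemma Admissible.pow (hφ : Admissible φ q p) (n : ℕ) :
    Admissible (fun q p => φ q p ^ n) q p :=
  ⟨hφ.1.pow n, hφ.2.pow n⟩

lemma LN_const (ε : ℝ) (U G : EuclideanSpace ℝ (Fin d) → ℝ) (c : ℝ) :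
    LN ε U G (fun _ _ => c) q p = 0 := by
  rw [LN_eq ε U G (Admissible.const c)]
  simp [secondDeriv_const]

lemma LN_add (ε : ℝ) (U G : EuclideanSpace ℝ (Fin d) → ℝ)
    (hφ : Admissible φ q p) (hψ : Admissible ψ q p) :
    LN ε U G (fun q p => φ q p + ψ q p) q p = LN ε U G φ q p + LN ε U G ψ q p := by
  rw [LN_eq ε U G (hφ.add hψ), LN_eq ε U G hφ, LN_eq ε U G hψ, fderiv_fun_add hφ.1 hψ.1,
    fderiv_fun_add (hφ.2.differentiable two_ne_zero p) (hψ.2.differentiable two_ne_zero p)]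
  simp_rw [secondDeriv_add hφ.2 hψ.2, Finset.sum_add_distrib]
  simp only [add_apply]
  ring

lemma LN_mul (ε : ℝ) (U G : EuclideanSpace ℝ (Fin d) → ℝ)
    (hφ : Admissible φ q p) (hψ : Admissible ψ q p) :
    LN ε U G (fun q p => φ q p * ψ q p) q p
      = φ q p * LN ε U G ψ q p + ψ q p * LN ε U G φ q p + 2 * carre φ ψ q p := by
  rw [LN_eq ε U G (hφ.mul hψ), LN_eq ε U G hφ, LN_eq ε U G hψ, fderiv_fun_mul hφ.1 hψ.1,
    fderiv_fun_mul (hφ.2.differentiable two_ne_zero p) (hψ.2.differentiable two_ne_zero p)]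
  simp_rw [secondDeriv_mul hφ.2 hψ.2, Finset.sum_add_distrib]
  simp only [add_apply, smul_apply, smul_eq_mul, carre,
    ← Finset.mul_sum]
  ring

lemma LN_const_mul (ε : ℝ) (U G : EuclideanSpace ℝ (Fin d) → ℝ) (c : ℝ)
    (hφ : Admissible φ q p) :
    LN ε U G (fun q p => c * φ q p) q p = c * LN ε U G φ q p := by
  rw [LN_mul ε U G (Admissible.const c) hφ, LN_const]
  simp [carre]

lemma carre_pow_right (hφ : Admissible φ q p) (n : ℕ) :
    carre φ (fun q p => φ q p ^ (n + 1)) q p = (n + 1) * φ q p ^ n * carre φ φ q p := by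
  have h : fderiv ℝ (fun p => φ q p ^ (n + 1)) p = _ :=
    fderiv_fun_pow (n + 1) (hφ.2.differentiable two_ne_zero p)
  unfold carre
  rw [h]
  simp only [Finset.mul_sum, smul_apply, smul_eq_mul]
  refine Finset.sum_congr rfl fun i _ => Finset.sum_congr rfl fun α _ => ?_
  simp
  ring

lemma LN_pow (ε : ℝ) (U G : EuclideanSpace ℝ (Fin d) → ℝ)
    (hφ : Admissible φ q p) (n : ℕ) :
    LN ε U G (fun q p => φ q p ^ (n + 1)) q p
      = (n + 1) * φ q p ^ n * LN ε U G φ q p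
        + (n + 1) * n * φ q p ^ (n - 1) * carre φ φ q p := by
  induction n with
  | zero => simp
  | succ n ih =>
    have h : (fun q p => φ q p ^ (n + 1 + 1)) = fun q p => φ q p * φ q p ^ (n + 1) := by
      funext q p; ring
    rw [h, LN_mul ε U G hφ (hφ.pow (n + 1)), ih, carre_pow_right hφ]
    rcases n with _ | n
    · simp; ring
    · simp only [Nat.add_sub_cancel]
      push_cast
      ring

end Generator

section Pairs

variable {N : ℕ}

/-- The ordered pairs `i < j` of particle indices. -/
def pairs (N : ℕ) : Finset (Fin N × Fin N) := Finset.univ.filter (fun x => x.1 < x.2)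

lemma ne_of_mem_pairs {x : Fin N × Fin N} (hx : x ∈ pairs N) : x.1 ≠ x.2 := by
  simp only [pairs, Finset.mem_filter, Finset.mem_univ, true_and] at hx
  exact hx.ne

lemma sum_lt_eq_sum_pairs {M : Type*} [AddCommMonoid M] (f : Fin N → Fin N → M) :
    ∑ i : Fin N, ∑ j ∈ Finset.univ.filter (fun j => i < j), f i j
      = ∑ x ∈ pairs N, f x.1 x.2 := by
  rw [pairs, Finset.sum_filter, Fintype.sum_prod_type]
  simp_rw [Finset.sum_filter]

lemma card_pairs_le : ((pairs N).card : ℝ) ≤ (N : ℝ) ^ 2 := by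
  have h : (pairs N).card ≤ (Finset.univ : Finset (Fin N × Fin N)).card :=
    Finset.card_le_card (Finset.filter_subset _ _)
  simp only [Finset.card_univ, Fintype.card_prod, Fintype.card_fin] at h
  rw [pow_two]
  exact_mod_cast h

variable {E : Type*} [NormedAddCommGroup E] [InnerProductSpace ℝ E]

lemma sum_inner_sum_ne_eq_sum_pairs {A : Fin N → Fin N → E} (hA : ∀ i j, i ≠ j → A j i = -A i j)
    (u : Fin N → E) :
    ∑ i, ⟪∑ j ∈ Finset.univ.filter (fun j => j ≠ i), A i j, u i⟫
      = ∑ x ∈ pairs N, ⟪A x.1 x.2, u x.1 - u x.2⟫ := by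
  rw [← sum_lt_eq_sum_pairs (fun i j => ⟪A i j, u i - u j⟫)]
  have h1 : ∀ i, ⟪∑ j ∈ Finset.univ.filter (fun j => j ≠ i), A i j, u i⟫
      = ∑ j, ((if i < j then ⟪A i j, u i⟫ else 0) + (if j < i then ⟪A i j, u i⟫ else 0)) := by
    intro i
    rw [sum_inner, Finset.sum_filter]
    refine Finset.sum_congr rfl fun j _ => ?_
    rcases lt_trichotomy i j with h | h | h
    · simp [h, h.ne', h.not_gt]
    · simp [h]
    · simp [h, h.ne, h.not_gt]
  simp_rw [h1, Finset.sum_add_distrib]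
  rw [Finset.sum_comm (f := fun i j => if j < i then ⟪A i j, u i⟫ else 0),
    ← Finset.sum_add_distrib]
  refine Finset.sum_congr rfl fun i _ => ?_
  rw [← Finset.sum_add_distrib, Finset.sum_filter]
  refine Finset.sum_congr rfl fun j _ => ?_
  split_ifs with h
  · rw [hA i j h.ne, inner_sub_right, inner_neg_left]
    ring
  · simp

end Pairs

section Kinetic

variable {E : Type*} [NormedAddCommGroup E] {ε : ℝ}

/-- The relativistic kinetic energy. -/
noncomputable def kin (ε : ℝ) (x : E) : ℝ := Real.sqrt (1 + ε * ‖x‖ ^ 2)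

lemma kin_sq (hε : 0 < ε) (x : E) : kin ε x ^ 2 = 1 + ε * ‖x‖ ^ 2 :=
  Real.sq_sqrt (by positivity)

lemma one_le_kin (hε : 0 < ε) (x : E) : 1 ≤ kin ε x :=
  Real.one_le_sqrt.mpr (by nlinarith [sq_nonneg ‖x‖])

lemma sqrt_mul_norm_le_kin (hε : 0 < ε) (x : E) : Real.sqrt ε * ‖x‖ ≤ kin ε x := by
  refine Real.le_sqrt_of_sq_le ?_
  rw [mul_pow, Real.sq_sqrt hε.le]
  linarith

variable [InnerProductSpace ℝ E]

lemma contDiff_kin (hε : 0 < ε) : ContDiff ℝ 2 (kin ε : E → ℝ) := by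
  unfold kin
  refine ContDiff.sqrt (contDiff_const.add (contDiff_const.mul (contDiff_norm_sq ℝ))) ?_
  intro x
  positivity

lemma hasFDerivAt_kin (hε : 0 < ε) (x : E) :
    HasFDerivAt (kin ε) ((ε * (kin ε x)⁻¹) • innerSL ℝ x) x := by
  have h1 : HasFDerivAt (fun x : E => 1 + ε * ‖x‖ ^ 2) (ε • (2 • innerSL ℝ x)) x :=
    ((hasStrictFDerivAt_norm_sq x).hasFDerivAt.const_mul ε).const_add 1
  have h2 := h1.sqrt (by positivity)
  refine h2.congr_fderiv ?_
  ext h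
  simp only [smul_apply, smul_eq_mul, innerSL_apply_apply, kin, nsmul_eq_mul]
  have : Real.sqrt (1 + ε * ‖x‖ ^ 2) ≠ 0 := by positivity
  field_simp
  push_cast
  ring

end Kinetic

section Hamiltonian

variable {d N : ℕ} {ε : ℝ} {U G : EuclideanSpace ℝ (Fin d) → ℝ}
  {q p : Fin N → EuclideanSpace ℝ (Fin d)}

/-- The total potential energy. -/
noncomputable def pot (U G : EuclideanSpace ℝ (Fin d) → ℝ)
    (q : Fin N → EuclideanSpace ℝ (Fin d)) : ℝ :=
  ∑ i, U (q i) + ∑ x ∈ pairs N, G (q x.1 - q x.2)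

lemma HN_eq (ε : ℝ) (U G : EuclideanSpace ℝ (Fin d) → ℝ)
    (q p : Fin N → EuclideanSpace ℝ (Fin d)) :
    HN ε U G q p = ε * pot U G q + ∑ i, kin ε (p i) := by
  unfold HN pot kin
  rw [sum_lt_eq_sum_pairs (fun i j => G (q i - q j))]
  ring

lemma sub_ne_zero_of_mem_pairs (hq : Function.Injective q) {x : Fin N × Fin N}
    (hx : x ∈ pairs N) : q x.1 - q x.2 ≠ 0 :=
  sub_ne_zero.mpr (hq.ne (ne_of_mem_pairs hx))

lemma hasFDerivAt_sub_apply (i j : Fin N) (q : Fin N → EuclideanSpace ℝ (Fin d)) :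
    HasFDerivAt (fun q : Fin N → EuclideanSpace ℝ (Fin d) => q i - q j)
      (ContinuousLinearMap.proj (R := ℝ) (φ := fun _ : Fin N => EuclideanSpace ℝ (Fin d)) i
        - ContinuousLinearMap.proj j) q :=
  (hasFDerivAt_apply i q).sub (hasFDerivAt_apply j q)

lemma pot_differentiable (hU : Differentiable ℝ U)
    (hG : ∀ x ≠ 0, DifferentiableAt ℝ G x) (hq : Function.Injective q) :
    DifferentiableAt ℝ (pot U G) q ∧ ∀ v, fderiv ℝ (pot U G) q v
      = ∑ i, ⟪gradient U (q i), v i⟫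
        + ∑ x ∈ pairs N, ⟪gradient G (q x.1 - q x.2), v x.1 - v x.2⟫ := by
  have h1 : ∀ i ∈ (Finset.univ : Finset (Fin N)),
      HasFDerivAt (fun q : Fin N → EuclideanSpace ℝ (Fin d) => U (q i))
      ((fderiv ℝ U (q i)).comp (ContinuousLinearMap.proj i)) q := fun i _ =>
    (hU (q i)).hasFDerivAt.comp q (hasFDerivAt_apply i q)
  have h2 : ∀ x ∈ pairs N,
      HasFDerivAt (fun q : Fin N → EuclideanSpace ℝ (Fin d) => G (q x.1 - q x.2))
      ((fderiv ℝ G (q x.1 - q x.2)).comp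
        (ContinuousLinearMap.proj x.1 - ContinuousLinearMap.proj x.2)) q := fun x hx =>
    HasFDerivAt.comp q (hG _ (sub_ne_zero_of_mem_pairs hq hx)).hasFDerivAt
      (hasFDerivAt_sub_apply x.1 x.2 q)
  have h3 := (HasFDerivAt.fun_sum h1).add (HasFDerivAt.fun_sum h2)
  refine ⟨h3.differentiableAt, fun v => ?_⟩
  have h4 : fderiv ℝ (pot U G) q = _ := h3.fderiv
  rw [h4]
  simp

lemma contDiff_HN (hε : 0 < ε) : ContDiff ℝ 2 (HN ε U G q) := by
  have : HN ε U G q = fun p => ε * pot U G q + ∑ i, kin ε (p i) := by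
    funext p; exact HN_eq ε U G q p
  rw [this]
  refine contDiff_const.add (ContDiff.sum fun i _ => ?_)
  exact (contDiff_kin hε).comp (contDiff_apply _ _ i)

lemma fderiv_HN_momentum (hε : 0 < ε) (u : Fin N → EuclideanSpace ℝ (Fin d)) :
    fderiv ℝ (HN ε U G q) p u = ε * ∑ i, ⟪vel ε p i, u i⟫ := by
  have h : HN ε U G q = fun p => ε * pot U G q + ∑ i, kin ε (p i) := by
    funext p; exact HN_eq ε U G q p
  have h1 : ∀ i ∈ (Finset.univ : Finset (Fin N)),
      HasFDerivAt (fun p : Fin N → EuclideanSpace ℝ (Fin d) => kin ε (p i))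
      (((ε * (kin ε (p i))⁻¹) • innerSL ℝ (p i)).comp (ContinuousLinearMap.proj i)) p :=
    fun i _ => HasFDerivAt.comp (g := kin ε)
      (f := fun p : Fin N → EuclideanSpace ℝ (Fin d) => p i) p
      (hasFDerivAt_kin hε (p i)) (hasFDerivAt_apply i p)
  rw [h, ((HasFDerivAt.fun_sum h1).const_add (ε * pot U G q)).fderiv, Finset.mul_sum]
  simp only [sum_apply, ContinuousLinearMap.comp_apply, smul_apply,
    ContinuousLinearMap.proj_apply, innerSL_apply_apply, smul_eq_mul, vel, kin]
  refine Finset.sum_congr rfl fun i _ => ?_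
  rw [real_inner_smul_left]
  ring

lemma admissible_HN (hε : 0 < ε) (hU : Differentiable ℝ U)
    (hG : ∀ x ≠ 0, DifferentiableAt ℝ G x) (hq : Function.Injective q) :
    Admissible (HN ε U G) q p := by
  refine ⟨?_, contDiff_HN hε⟩
  simp_rw [HN_eq]
  exact ((pot_differentiable hU hG hq).1.const_mul ε).add_const _

lemma fderiv_HN_position (hU : Differentiable ℝ U)
    (hG : ∀ x ≠ 0, DifferentiableAt ℝ G x) (hq : Function.Injective q)
    (v : Fin N → EuclideanSpace ℝ (Fin d)) :
    fderiv ℝ (fun q => HN ε U G q p) q v = ε * (∑ i, ⟪gradient U (q i), v i⟫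
        + ∑ x ∈ pairs N, ⟪gradient G (q x.1 - q x.2), v x.1 - v x.2⟫) := by
  simp_rw [HN_eq]
  obtain ⟨h1, h2⟩ := pot_differentiable hU hG hq
  rw [((h1.hasFDerivAt.const_mul ε).add_const _).fderiv, ← h2]
  rfl

lemma inner_dir (w : Fin N → EuclideanSpace ℝ (Fin d)) (i : Fin N) (α : Fin d) :
    ∑ k, ⟪w k, dir i α k⟫ = ⟪w i, EuclideanSpace.single α (1 : ℝ)⟫ := by
  rw [Finset.sum_eq_single i]
  · simp [dir]
  · intro k _ hk
    simp [dir, hk]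
  · simp

lemma secondDeriv_HN_mem (hε : 0 < ε) (i : Fin N) (α : Fin d) :
    secondDeriv (HN ε U G q) p (dir i α) ∈ Set.Icc 0 ε := by
  set e : EuclideanSpace ℝ (Fin d) := EuclideanSpace.single α (1 : ℝ) with he
  have hen : ‖e‖ = 1 := by simp [he]
  have h : (fun x => fderiv ℝ (HN ε U G q) x (dir i α))
      = fun x => ε * ((kin ε (x i))⁻¹ * ⟪x i, e⟫) := by
    funext x
    rw [fderiv_HN_momentum hε, inner_dir, vel, real_inner_smul_left]
    rfl
  have hk : 0 < kin ε (p i) := lt_of_lt_of_le one_pos (one_le_kin hε _)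
  have h1 : HasFDerivAt (fun x : EuclideanSpace ℝ (Fin d) => ε * ((kin ε x)⁻¹ * ⟪x, e⟫)) _ (p i) :=
    (((hasDerivAt_inv hk.ne').comp_hasFDerivAt (p i) (hasFDerivAt_kin hε (p i))).mul
      ((hasFDerivAt_id (p i)).inner ℝ (hasFDerivAt_const e (p i)))).const_mul ε
  have h2 := HasFDerivAt.comp (f := fun p : Fin N → EuclideanSpace ℝ (Fin d) => p i) p h1
    (hasFDerivAt_apply i p)
  have h3 : secondDeriv (HN ε U G q) p (dir i α)
      = ε * ((kin ε (p i))⁻¹ ^ 3 * (kin ε (p i) ^ 2 - ε * ⟪p i, e⟫ ^ 2)) := by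
    unfold secondDeriv
    rw [h]
    have h4 : fderiv ℝ (fun x : Fin N → EuclideanSpace ℝ (Fin d) =>
      ε * ((kin ε (x i))⁻¹ * ⟪x i, e⟫)) p = _ := h2.fderiv
    rw [h4]
    have h5 : (dir i α : Fin N → EuclideanSpace ℝ (Fin d)) i = e := by simp [dir, he]
    simp [h5, fderivInnerCLM_apply, hen]
    field_simp
    ring
  have hcs : ⟪p i, e⟫ ^ 2 ≤ ‖p i‖ ^ 2 := by
    have := abs_real_inner_le_norm (p i) e
    rw [hen, mul_one] at this
    rw [← sq_abs]
    gcongr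
  have hk2 := kin_sq hε (p i)
  have hk1 := one_le_kin hε (p i)
  have hinv : (kin ε (p i))⁻¹ ≤ 1 := inv_le_one_of_one_le₀ hk1
  have hinv0 : 0 < (kin ε (p i))⁻¹ := inv_pos.mpr hk
  rw [h3]
  have h6 : 0 ≤ kin ε (p i) ^ 2 - ε * ⟪p i, e⟫ ^ 2 := by nlinarith
  refine ⟨by positivity, ?_⟩
  have h7 : (kin ε (p i))⁻¹ ^ 3 * (kin ε (p i) ^ 2 - ε * ⟪p i, e⟫ ^ 2) ≤ 1 := by
    calc (kin ε (p i))⁻¹ ^ 3 * (kin ε (p i) ^ 2 - ε * ⟪p i, e⟫ ^ 2)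
        ≤ (kin ε (p i))⁻¹ ^ 3 * kin ε (p i) ^ 2 := by
          gcongr; nlinarith [mul_nonneg hε.le (sq_nonneg ⟪p i, e⟫)]
      _ = (kin ε (p i))⁻¹ := by field_simp
      _ ≤ 1 := hinv
  nlinarith

lemma LN_HN (hε : 0 < ε) (hU : Differentiable ℝ U)
    (hG : ∀ x ≠ 0, DifferentiableAt ℝ G x)
    (hGodd : ∀ x ≠ 0, gradient G (-x) = -gradient G x) (hq : Function.Injective q) :
    LN ε U G (HN ε U G) q p = -ε * ∑ i, ‖vel ε p i‖ ^ 2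
      + ∑ i, ∑ α, secondDeriv (HN ε U G q) p (dir i α) := by
  rw [LN_eq ε U G (admissible_HN hε hU hG hq), fderiv_HN_position hU hG hq,
    fderiv_HN_momentum hε]
  congr 1
  have h := sum_inner_sum_ne_eq_sum_pairs (A := fun i j => gradient G (q i - q j))
    (fun i j hij => by
      rw [← neg_sub (q i) (q j)]; exact hGodd _ (sub_ne_zero.mpr (hq.ne hij))) (vel ε p)
  rw [← h]
  simp only [force, inner_sub_right, inner_neg_right, Finset.sum_sub_distrib,
    Finset.sum_neg_distrib, real_inner_self_eq_norm_sq, interGrad]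
  simp_rw [fun i => real_inner_comm (vel ε p i) (gradient U (q i)),
    fun i => real_inner_comm (vel ε p i) (∑ j ∈ Finset.univ.filter (fun j => j ≠ i), gradient G (q i - q j))]
  ring

end Hamiltonian

section SingularField

variable {E : Type*} [NormedAddCommGroup E] [InnerProductSpace ℝ E] {s : ℝ}

/-- The field `x / |x|^s`. -/
noncomputable def sing (s : ℝ) (x : E) : E := (‖x‖ ^ s)⁻¹ • x

lemma sing_neg (s : ℝ) (x : E) : sing s (-x) = -sing s x := by
  simp [sing]

lemma sing_zero (s : ℝ) : sing s (0 : E) = 0 := by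
  simp [sing]

lemma norm_sing {x : E} (hx : x ≠ 0) : ‖sing s x‖ = ‖x‖ ^ (1 - s) := by
  have h : 0 < ‖x‖ := norm_pos_iff.mpr hx
  rw [sing, norm_smul, norm_inv, Real.norm_of_nonneg (by positivity), ← Real.rpow_neg h.le,
    sub_eq_neg_add, Real.rpow_add h, Real.rpow_one]

lemma norm_sing_le (hs0 : 0 ≤ s) (hs1 : s ≤ 1) (x : E) : ‖sing s x‖ ≤ 1 + ‖x‖ := by
  rcases eq_or_ne x 0 with rfl | hx
  · simp [sing_zero]
  rw [norm_sing hx]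
  rcases le_total ‖x‖ 1 with h | h
  · have := Real.rpow_le_one (norm_nonneg x) h (sub_nonneg.mpr hs1)
    linarith [norm_nonneg x]
  · have := Real.rpow_le_rpow_of_exponent_le h (show 1 - s ≤ 1 by linarith)
    rw [Real.rpow_one] at this
    linarith

lemma inner_self_sing {x : E} (hx : x ≠ 0) : ⟪x, sing s x⟫ = ‖x‖ ^ (2 - s) := by
  have h : 0 < ‖x‖ := norm_pos_iff.mpr hx
  rw [sing, real_inner_smul_right, real_inner_self_eq_norm_sq, ← Real.rpow_neg h.le,
    ← Real.rpow_natCast, ← Real.rpow_add h]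
  congr 1
  push_cast
  ring

/-- The field `x / |x|^s` is monotone for `0 ≤ s ≤ 1`. -/
lemma inner_sub_sing_sub_nonneg (hs1 : s ≤ 1) (x y : E) :
    0 ≤ ⟪x - y, sing s x - sing s y⟫ := by
  rcases eq_or_ne x 0 with rfl | hx
  · rcases eq_or_ne y 0 with rfl | hy
    · simp
    · simp only [sing_zero, zero_sub, inner_neg_neg, inner_self_sing hy]
      positivity
  rcases eq_or_ne y 0 with rfl | hy
  · simp only [sing_zero, sub_zero, inner_self_sing hx]
    positivity
  have ha : 0 < ‖x‖ := norm_pos_iff.mpr hx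
  have hb : 0 < ‖y‖ := norm_pos_iff.mpr hy
  have hxy : ⟪x, y⟫ ≤ ‖x‖ * ‖y‖ := real_inner_le_norm x y
  have hA : ‖x‖ ^ (1 - s) = (‖x‖ ^ s)⁻¹ * ‖x‖ := by
    rw [← Real.rpow_neg ha.le, sub_eq_neg_add, Real.rpow_add ha, Real.rpow_one]
  have hB : ‖y‖ ^ (1 - s) = (‖y‖ ^ s)⁻¹ * ‖y‖ := by
    rw [← Real.rpow_neg hb.le, sub_eq_neg_add, Real.rpow_add hb, Real.rpow_one]
  have key : 0 ≤ (‖x‖ ^ (1 - s) - ‖y‖ ^ (1 - s)) * (‖x‖ - ‖y‖) := by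
    rcases le_total ‖x‖ ‖y‖ with h | h
    · exact mul_nonneg_of_nonpos_of_nonpos
        (sub_nonpos.mpr (Real.rpow_le_rpow ha.le h (by linarith))) (sub_nonpos.mpr h)
    · exact mul_nonneg
        (sub_nonneg.mpr (Real.rpow_le_rpow hb.le h (by linarith))) (sub_nonneg.mpr h)
  have hu : 0 < (‖x‖ ^ s)⁻¹ := by positivity
  have hv : 0 < (‖y‖ ^ s)⁻¹ := by positivity
  rw [hA, hB] at key
  simp only [sing, inner_sub_left, inner_sub_right, real_inner_smul_right,
    real_inner_self_eq_norm_sq]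
  rw [real_inner_comm x y]
  nlinarith [mul_nonneg hu.le (sub_nonneg.mpr hxy), mul_nonneg hv.le (sub_nonneg.mpr hxy)]

lemma sing_hasFDerivAt (hs0 : 0 ≤ s) (hs1 : s ≤ 1) {x : E} (hx : x ≠ 0) :
    DifferentiableAt ℝ (sing s) x ∧ ∀ h, ‖fderiv ℝ (sing s) x h‖ ≤ 2 * ‖x‖ ^ (-s) * ‖h‖ := by
  have ha : 0 < ‖x‖ := norm_pos_iff.mpr hx
  have h1 : HasFDerivAt (fun x : E => (‖x‖ ^ 2) ^ (-s / 2)) _ x :=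
    (hasStrictFDerivAt_norm_sq x).hasFDerivAt.rpow_const (p := -s / 2) (Or.inl (by positivity))
  have h2 := h1.fun_smul (hasFDerivAt_id x)
  have h3 : (sing s : E → E) = fun x => (‖x‖ ^ 2) ^ (-s / 2) • id x := by
    funext y
    rw [sing, ← Real.rpow_neg (norm_nonneg y), ← Real.rpow_natCast,
      ← Real.rpow_mul (norm_nonneg y)]
    simp only [id]
    congr 2
    push_cast
    ring
  rw [← h3] at h2
  refine ⟨h2.differentiableAt, fun h => ?_⟩
  have hp1 : (‖x‖ ^ 2) ^ (-s / 2) = ‖x‖ ^ (-s) := by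
    rw [← Real.rpow_natCast, ← Real.rpow_mul ha.le]
    congr 1
    push_cast
    ring
  have hp2 : (‖x‖ ^ 2) ^ (-s / 2 - 1) * ‖x‖ ^ 2 = ‖x‖ ^ (-s) := by
    rw [← hp1, Real.rpow_sub_one (by positivity)]
    field_simp
  rw [h2.fderiv]
  simp only [add_apply, smul_apply, ContinuousLinearMap.smulRight_apply, id,
    innerSL_apply_apply, smul_eq_mul, nsmul_eq_mul, ContinuousLinearMap.id_apply]
  refine (norm_add_le _ _).trans ?_
  rw [norm_smul, norm_smul, hp1, Real.norm_of_nonneg (by positivity : 0 ≤ ‖x‖ ^ (-s))]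
  have hcs := abs_real_inner_le_norm x h
  have hpp : 0 < (‖x‖ ^ 2) ^ (-s / 2 - 1) := by positivity
  have h4 : ‖-s / 2 * (‖x‖ ^ 2) ^ (-s / 2 - 1) * ((2 : ℕ) * ⟪x, h⟫)‖
      = s * ((‖x‖ ^ 2) ^ (-s / 2 - 1) * |⟪x, h⟫|) := by
    rw [Real.norm_eq_abs, show -s / 2 * (‖x‖ ^ 2) ^ (-s / 2 - 1) * ((2 : ℕ) * ⟪x, h⟫)
      = -(s * ((‖x‖ ^ 2) ^ (-s / 2 - 1) * ⟪x, h⟫)) by push_cast; ring, abs_neg, abs_mul, abs_mul,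
      abs_of_nonneg hs0, abs_of_pos hpp]
  have h5 : s * ((‖x‖ ^ 2) ^ (-s / 2 - 1) * |⟪x, h⟫|) * ‖x‖ ≤ ‖x‖ ^ (-s) * ‖h‖ := by
    calc s * ((‖x‖ ^ 2) ^ (-s / 2 - 1) * |⟪x, h⟫|) * ‖x‖
        ≤ 1 * ((‖x‖ ^ 2) ^ (-s / 2 - 1) * (‖x‖ * ‖h‖)) * ‖x‖ := by gcongr
      _ = (‖x‖ ^ 2) ^ (-s / 2 - 1) * ‖x‖ ^ 2 * ‖h‖ := by ring
      _ = _ := by rw [hp2]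
  have h6 : ‖-s / 2 * (‖x‖ ^ 2) ^ (-s / 2 - 1) * ((2 : ℕ) * ⟪x, h⟫)‖ * ‖x‖
      ≤ ‖x‖ ^ (-s) * ‖h‖ := by rw [h4]; exact h5
  push_cast at h6 ⊢
  linarith

end SingularField

section Bilinear

variable {d N : ℕ} {ε s : ℝ} {U G : EuclideanSpace ℝ (Fin d) → ℝ}
  {q p : Fin N → EuclideanSpace ℝ (Fin d)}

/-- The virial `∑ᵢ ⟨qᵢ, pᵢ⟩`. -/
noncomputable def virial (q p : Fin N → EuclideanSpace ℝ (Fin d)) : ℝ := ∑ i, ⟪q i, p i⟫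

/-- The singular corrector `∑_{i<j} ⟨(qᵢ - qⱼ) / |qᵢ - qⱼ|^s, pᵢ - pⱼ⟩`. -/
noncomputable def corr (s : ℝ) (q p : Fin N → EuclideanSpace ℝ (Fin d)) : ℝ :=
  ∑ x ∈ pairs N, ⟪sing s (q x.1 - q x.2), p x.1 - p x.2⟫

lemma VN_eq (ε β₁ A₁ A₂ κ : ℝ) (U G : EuclideanSpace ℝ (Fin d) → ℝ)
    (q p : Fin N → EuclideanSpace ℝ (Fin d)) :
    VN ε β₁ A₁ A₂ κ U G q p = A₁ * HN ε U G q p ^ 3 + ε * (HN ε U G q p * virial q p)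
      + (-(A₂ * ε ^ 2)) * corr (β₁ - 1) q p + κ := by
  unfold VN virial corr
  rw [sum_lt_eq_sum_pairs
    (fun i j => ⟪q i - q j, p i - p j⟫ / ‖q i - q j‖ ^ (β₁ - 1))]
  simp only [sing, real_inner_smul_left, div_eq_inv_mul]
  ring

lemma fderiv_virial_momentum (u : Fin N → EuclideanSpace ℝ (Fin d)) :
    fderiv ℝ (virial q) p u = ∑ i, ⟪q i, u i⟫ := by
  have h : ∀ i ∈ (Finset.univ : Finset (Fin N)),
      HasFDerivAt (fun p : Fin N → EuclideanSpace ℝ (Fin d) => ⟪q i, p i⟫)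
      ((innerSL ℝ (q i)).comp (ContinuousLinearMap.proj i)) p := fun i _ =>
    HasFDerivAt.comp (f := fun p : Fin N → EuclideanSpace ℝ (Fin d) => p i) p
      (innerSL ℝ (q i)).hasFDerivAt (hasFDerivAt_apply i p)
  have h2 : fderiv ℝ (virial q) p = _ := (HasFDerivAt.fun_sum h).fderiv
  rw [h2]
  simp

lemma virial_comm : virial q p = virial p q := by
  simp only [virial, real_inner_comm]

lemma contDiff_virial : ContDiff ℝ 2 (virial q) :=
  ContDiff.sum fun i _ => contDiff_const.inner ℝ (contDiff_apply _ _ i)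

lemma admissible_virial : Admissible virial q p := by
  refine ⟨?_, contDiff_virial⟩
  simp_rw [fun x => virial_comm (q := x) (p := p)]
  exact (contDiff_virial.differentiable two_ne_zero) q

lemma LN_virial : LN ε U G virial q p
    = ∑ i, ⟪p i, vel ε p i⟫ + ∑ i, ⟪q i, force ε U G q p i⟫ := by
  rw [LN_eq ε U G admissible_virial, fderiv_virial_momentum]
  simp_rw [fun x => virial_comm (q := x) (p := p), secondDeriv, fderiv_virial_momentum]
  simp

lemma fderiv_corr_momentum (u : Fin N → EuclideanSpace ℝ (Fin d)) :
    fderiv ℝ (corr s q) p u = ∑ x ∈ pairs N, ⟪sing s (q x.1 - q x.2), u x.1 - u x.2⟫ := by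
  have h : ∀ x ∈ pairs N,
      HasFDerivAt (fun p : Fin N → EuclideanSpace ℝ (Fin d) =>
        ⟪sing s (q x.1 - q x.2), p x.1 - p x.2⟫)
      ((innerSL ℝ (sing s (q x.1 - q x.2))).comp
        (ContinuousLinearMap.proj x.1 - ContinuousLinearMap.proj x.2)) p := fun x _ =>
    HasFDerivAt.comp p (innerSL ℝ (sing s (q x.1 - q x.2))).hasFDerivAt
      (hasFDerivAt_sub_apply x.1 x.2 p)
  have h2 : fderiv ℝ (corr s q) p = _ := (HasFDerivAt.fun_sum h).fderiv
  rw [h2]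
  simp [inner_sub_right]

lemma corr_differentiable (hs0 : 0 ≤ s) (hs1 : s ≤ 1) (hq : Function.Injective q) :
    DifferentiableAt ℝ (fun q => corr s q p) q ∧ ∀ v, fderiv ℝ (fun q => corr s q p) q v
      = ∑ x ∈ pairs N, ⟪fderiv ℝ (sing s) (q x.1 - q x.2) (v x.1 - v x.2), p x.1 - p x.2⟫ := by
  have h1 : ∀ x ∈ pairs N, HasFDerivAt
      (fun q : Fin N → EuclideanSpace ℝ (Fin d) => sing s (q x.1 - q x.2))
      ((fderiv ℝ (sing s) (q x.1 - q x.2)).comp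
        (ContinuousLinearMap.proj x.1 - ContinuousLinearMap.proj x.2)) q := fun x hx =>
    HasFDerivAt.comp (g := sing s)
      (f := fun q : Fin N → EuclideanSpace ℝ (Fin d) => q x.1 - q x.2) q
      (sing_hasFDerivAt hs0 hs1 (sub_ne_zero_of_mem_pairs hq hx)).1.hasFDerivAt
      (hasFDerivAt_sub_apply x.1 x.2 q)
  have h2 := HasFDerivAt.fun_sum fun x hx =>
    (h1 x hx).inner ℝ (hasFDerivAt_const (p x.1 - p x.2) q)
  refine ⟨h2.differentiableAt, fun v => ?_⟩
  have h3 : fderiv ℝ (fun q => corr s q p) q = _ := h2.fderiv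
  rw [h3]
  simp [fderivInnerCLM_apply]

lemma admissible_corr (hs0 : 0 ≤ s) (hs1 : s ≤ 1) (hq : Function.Injective q) :
    Admissible (corr s) q p :=
  ⟨(corr_differentiable hs0 hs1 hq).1, ContDiff.sum fun x _ =>
    contDiff_const.inner ℝ ((contDiff_apply _ _ x.1).sub (contDiff_apply _ _ x.2))⟩

lemma LN_corr (hs0 : 0 ≤ s) (hs1 : s ≤ 1) (hq : Function.Injective q) :
    LN ε U G (corr s) q p
      = ∑ x ∈ pairs N,
          ⟪fderiv ℝ (sing s) (q x.1 - q x.2) (vel ε p x.1 - vel ε p x.2), p x.1 - p x.2⟫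
        + ∑ x ∈ pairs N,
          ⟪sing s (q x.1 - q x.2), force ε U G q p x.1 - force ε U G q p x.2⟫ := by
  rw [LN_eq ε U G (admissible_corr hs0 hs1 hq), fderiv_corr_momentum,
    (corr_differentiable hs0 hs1 hq).2]
  simp_rw [secondDeriv, fderiv_corr_momentum]
  simp

end Bilinear

section Growth

variable {d : ℕ}

/-- The standing assumptions on the potentials; `s` stands for `β₁ - 1`. -/
structure Potentials (U G : EuclideanSpace ℝ (Fin d) → ℝ)
    (a₁ lam a₂ a₃ s β₂ a₄ a₅ a₆ : ℝ) : Prop where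
  a₁_pos : 0 < a₁
  one_le_lam : 1 ≤ lam
  a₂_pos : 0 < a₂
  a₃_pos : 0 < a₃
  s_pos : 0 < s
  s_le_one : s ≤ 1
  β₂_nonneg : 0 ≤ β₂
  β₂_le : β₂ ≤ s
  a₄_pos : 0 < a₄
  a₆_pos : 0 < a₆
  U_diff : Differentiable ℝ U
  U_low : ∀ q, (1 / a₁) * ‖q‖ ^ (lam + 1) - a₁ ≤ U q
  U_up : ∀ q, U q ≤ a₁ * (1 + ‖q‖ ^ (lam + 1))
  U_grad : ∀ q, ‖gradient U q‖ ≤ a₁ * (1 + ‖q‖ ^ lam)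
  U_coer : ∀ q, a₂ * ‖q‖ ^ (lam + 1) - a₃ ≤ ⟪gradient U q, q⟫
  G_diff : ∀ q ≠ 0, DifferentiableAt ℝ G q
  G_odd : ∀ q ≠ 0, gradient G (-q) = -gradient G q
  G_bd : ∀ q ≠ 0, |G q| ≤ a₁ * (1 + ‖q‖ + ‖q‖ ^ (-(s + 1)))
  G_grad : ∀ q ≠ 0, ‖gradient G q‖ ≤ a₁ * (1 + ‖q‖ ^ (-(s + 1)))
  G_struct : ∀ q ≠ 0,
    ‖gradient G q + (a₄ / ‖q‖ ^ (s + 2)) • q + (a₅ / ‖q‖ ^ (β₂ + 1)) • q‖ ≤ a₆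

lemma le_of_deriv_le_rpow {f f' : ℝ → ℝ} {τ s A B : ℝ} (hτ : 0 < τ) (hτ1 : τ ≤ 1) (hs : 0 < s)
    (hf : ∀ t ∈ Set.Icc τ 1, HasDerivAt f (f' t) t)
    (hf' : ∀ t ∈ Set.Icc τ 1, f' t ≤ -A * t ^ (-(s + 1)) + B) :
    f 1 + A / s * (τ ^ (-s) - 1) - B * (1 - τ) ≤ f τ := by
  have hd : ∀ t ∈ Set.Icc τ 1,
      HasDerivAt (fun t => f t - (A / s * t ^ (-s) + B * t))
        (f' t - (A / s * (-s * t ^ (-s - 1)) + B)) t := by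
    intro t ht
    have ht0 : t ≠ 0 := (hτ.trans_le ht.1).ne'
    have h1 := (Real.hasDerivAt_rpow_const (p := -s) (Or.inl ht0)).const_mul (A / s)
    have h2 := (hasDerivAt_id t).const_mul B
    have h3 := (hf t ht).fun_sub (h1.fun_add h2)
    simpa using h3
  have hanti : AntitoneOn (fun t => f t - (A / s * t ^ (-s) + B * t)) (Set.Icc τ 1) := by
    refine antitoneOn_of_deriv_nonpos (convex_Icc τ 1)
      (fun t ht => (hd t ht).continuousAt.continuousWithinAt)
      (fun t ht => (hd t (interior_subset ht)).differentiableAt.differentiableWithinAt) ?_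
    intro t ht
    have ht' := interior_subset ht
    rw [(hd t ht').deriv]
    have h1 := hf' t ht'
    have h2 : A / s * (-s * t ^ (-s - 1)) = -A * t ^ (-(s + 1)) := by
      rw [show -s - 1 = -(s + 1) by ring]
      field_simp
    linarith
  have h := hanti (Set.left_mem_Icc.mpr hτ1) (Set.right_mem_Icc.mpr hτ1) hτ1
  simp only [Real.one_rpow] at h
  linarith

lemma rpow_neg_le_of_le {t a b : ℝ} (ht : 0 < t) (ha : 0 ≤ a) (hab : a ≤ b) :
    t ^ (-a) ≤ 1 + t ^ (-b) := by
  rcases le_total t 1 with h | h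
  · have := Real.rpow_le_rpow_of_exponent_ge ht h (neg_le_neg hab)
    linarith
  · have := Real.rpow_le_one_of_one_le_of_nonpos h (neg_nonpos.mpr ha)
    have h2 : 0 < t ^ (-b) := by positivity
    linarith

lemma rpow_neg_le_small {t δ s : ℝ} (ht : 0 < t) (hδ : 0 < δ) (hs : 0 ≤ s) :
    t ^ (-s) ≤ δ * t ^ (-(s + 1)) + δ ^ (-s) := by
  rcases le_total t δ with h | h
  · have h1 : t ^ (-s) = t * t ^ (-(s + 1)) := by
      nth_rewrite 2 [← Real.rpow_one t]
      rw [← Real.rpow_add ht]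
      congr 1
      ring
    have h2 : 0 < t ^ (-(s + 1)) := by positivity
    have h3 : 0 < δ ^ (-s) := by positivity
    rw [h1]
    nlinarith
  · have h1 := Real.rpow_le_rpow_of_nonpos hδ h (neg_nonpos.mpr hs)
    have h2 : 0 < t ^ (-(s + 1)) := by positivity
    nlinarith

namespace Potentials

variable {U G : EuclideanSpace ℝ (Fin d) → ℝ} {a₁ lam a₂ a₃ s β₂ a₄ a₅ a₆ : ℝ}

lemma norm_gradient_add_le (h : Potentials U G a₁ lam a₂ a₃ s β₂ a₄ a₅ a₆)
    {x : EuclideanSpace ℝ (Fin d)} (hx : x ≠ 0) :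
    ‖gradient G x + (a₄ / ‖x‖ ^ (s + 2)) • x‖ ≤ |a₅| * ‖x‖ ^ (-β₂) + a₆ := by
  have hx0 : 0 < ‖x‖ := norm_pos_iff.mpr hx
  have h1 := h.G_struct x hx
  have h2 : ‖(a₅ / ‖x‖ ^ (β₂ + 1)) • x‖ = |a₅| * ‖x‖ ^ (-β₂) := by
    rw [norm_smul, Real.norm_eq_abs, abs_div, abs_of_pos (by positivity : 0 < ‖x‖ ^ (β₂ + 1)),
      Real.rpow_add_one hx0.ne', Real.rpow_neg hx0.le]
    field_simp
  have h3 := norm_sub_le (gradient G x + (a₄ / ‖x‖ ^ (s + 2)) • x + (a₅ / ‖x‖ ^ (β₂ + 1)) • x)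
    ((a₅ / ‖x‖ ^ (β₂ + 1)) • x)
  rw [add_sub_cancel_right, h2] at h3
  linarith

lemma exists_G_bounds (h : Potentials U G a₁ lam a₂ a₃ s β₂ a₄ a₅ a₆) :
    ∃ c C : ℝ, 0 < c ∧ 0 < C ∧ ∀ x ≠ 0,
      c * ‖x‖ ^ (-s) - C * (1 + ‖x‖) ≤ G x ∧ G x ≤ C * (1 + ‖x‖ + ‖x‖ ^ (-s)) := by
  have hs := h.s_pos
  have ha₁ := h.a₁_pos
  have ha₄ := h.a₄_pos
  have ha₆ := h.a₆_pos
  set δ : ℝ := a₄ / (2 * (|a₅| + 1)) with hδ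
  have hδ0 : 0 < δ := by positivity
  have hδa : |a₅| * δ ≤ a₄ / 2 := by
    rw [hδ]
    rw [← mul_div_assoc, div_le_div_iff₀ (by positivity) (by positivity)]
    nlinarith [abs_nonneg a₅]
  set B : ℝ := |a₅| * (1 + δ ^ (-s)) + a₆ with hB
  have hB0 : 0 < B := by positivity
  have hray : ∀ x : EuclideanSpace ℝ (Fin d), x ≠ 0 → ‖x‖ ≤ 1 →
      a₄ / (2 * s) * ‖x‖ ^ (-s) - (3 * a₁ + a₄ / (2 * s) + B) ≤ G x ∧
      G x ≤ 4 * a₁ + a₁ / s * ‖x‖ ^ (-s) := by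
    intro x hx hx1
    have hx0 : 0 < ‖x‖ := norm_pos_iff.mpr hx
    obtain ⟨u, hun, hxu⟩ : ∃ u : EuclideanSpace ℝ (Fin d), ‖u‖ = 1 ∧ ‖x‖ • u = x :=
      ⟨‖x‖⁻¹ • x, by rw [norm_smul, norm_inv, norm_norm, inv_mul_cancel₀ hx0.ne'],
        smul_inv_smul₀ hx0.ne' x⟩
    have hu0 : u ≠ 0 := by
      rw [← norm_pos_iff, hun]; exact one_pos
    have htu : ∀ t : ℝ, 0 < t → t • u ≠ 0 := fun t ht => smul_ne_zero ht.ne' hu0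
    have hnt : ∀ t : ℝ, 0 < t → ‖t • u‖ = t := fun t ht => by
      rw [norm_smul, hun, mul_one, Real.norm_of_nonneg ht.le]
    have hder : ∀ t ∈ Set.Icc ‖x‖ 1,
        HasDerivAt (fun t : ℝ => G (t • u)) ⟪gradient G (t • u), u⟫ t := by
      intro t ht
      have h1 := (h.G_diff _ (htu t (hx0.trans_le ht.1))).hasFDerivAt
      have h2 : HasDerivAt (fun t : ℝ => t • u) ((1 : ℝ) • u) t :=
        (hasDerivAt_id t).smul_const u
      have h3 := h1.comp_hasDerivAt t h2
      rw [inner_gradient_eq_fderiv]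
      simpa [Function.comp_def] using h3
    have hG1 := abs_le.mp (h.G_bd u hu0)
    rw [hun, Real.one_rpow] at hG1
    have hlow := le_of_deriv_le_rpow (A := a₄ / 2) (B := B) hx0 hx1 hs hder (by
      intro t ht
      have ht0 := hx0.trans_le ht.1
      have h1 := h.norm_gradient_add_le (htu t ht0)
      rw [hnt t ht0] at h1
      have h2 := (real_inner_le_norm _ u).trans (mul_le_mul_of_nonneg_right h1 (norm_nonneg u))
      rw [hun, mul_one, inner_add_left, real_inner_smul_left, real_inner_smul_left,
        real_inner_self_eq_norm_sq, hun] at h2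
      have h3 : a₄ / t ^ (s + 2) * (t * 1 ^ 2) = a₄ * t ^ (-(s + 1)) := by
        rw [show s + 2 = (s + 1) + 1 by ring, Real.rpow_add_one ht0.ne', Real.rpow_neg ht0.le]
        field_simp
      rw [h3] at h2
      have h4 := rpow_neg_le_of_le ht0 h.β₂_nonneg h.β₂_le
      have h5 := rpow_neg_le_small ht0 hδ0 hs.le
      have h6 : |a₅| * t ^ (-β₂) ≤ |a₅| * (1 + (δ * t ^ (-(s + 1)) + δ ^ (-s))) := by
        gcongr; linarith
      have h7 : |a₅| * δ * t ^ (-(s + 1)) ≤ a₄ / 2 * t ^ (-(s + 1)) := by gcongr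
      rw [hB]
      linarith)
    have hup := le_of_deriv_le_rpow (f := fun t => -G (t • u)) (A := -a₁) (B := a₁) hx0 hx1 hs
      (fun t ht => (hder t ht).neg) (by
        intro t ht
        have ht0 := hx0.trans_le ht.1
        have h1 := h.G_grad _ (htu t ht0)
        rw [hnt t ht0] at h1
        have h2 := abs_le.mp (abs_real_inner_le_norm (gradient G (t • u)) u)
        rw [hun, mul_one] at h2
        linarith [h2.1])
    simp only [one_smul, hxu] at hlow hup
    have e1 : a₄ / 2 / s = a₄ / (2 * s) := by rw [div_div]
    rw [e1] at hlow
    have e2 : B * (1 - ‖x‖) ≤ B := by nlinarith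
    have e3 : a₁ * (1 - ‖x‖) ≤ a₁ := by nlinarith
    have e4 : 0 < a₁ / s := by positivity
    rw [neg_div] at hup
    constructor <;> linarith [hG1.1, hG1.2]
  have hc0 : 0 < a₄ / (2 * s) := by positivity
  have hc1 : 0 < a₁ / s := by positivity
  refine ⟨a₄ / (2 * s), 4 * a₁ + a₄ / (2 * s) + B + a₁ / s, hc0, by positivity,
    fun x hx => ?_⟩
  have hx0 : 0 < ‖x‖ := norm_pos_iff.mpr hx
  have hxs : 0 < ‖x‖ ^ (-s) := by positivity
  set C : ℝ := 4 * a₁ + a₄ / (2 * s) + B + a₁ / s with hC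
  have hCx : 0 ≤ C * ‖x‖ := by positivity
  rcases le_total ‖x‖ 1 with hx1 | hx1
  · obtain ⟨h1, h2⟩ := hray x hx hx1
    have h3 : a₁ / s * ‖x‖ ^ (-s) ≤ C * ‖x‖ ^ (-s) := by
      gcongr; linarith
    constructor <;> linarith
  · have h1 := abs_le.mp (h.G_bd x hx)
    have h2 : ‖x‖ ^ (-(s + 1)) ≤ 1 :=
      Real.rpow_le_one_of_one_le_of_nonpos hx1 (by linarith)
    have h3 : ‖x‖ ^ (-s) ≤ 1 := Real.rpow_le_one_of_one_le_of_nonpos hx1 (by linarith)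
    have h4 : a₁ * ‖x‖ ^ (-(s + 1)) ≤ a₁ := by nlinarith
    have h5 : a₄ / (2 * s) * ‖x‖ ^ (-s) ≤ a₄ / (2 * s) := by nlinarith
    have h6 : a₁ * ‖x‖ ≤ C * ‖x‖ := by gcongr; linarith
    have h7 : 0 ≤ C * ‖x‖ ^ (-s) := by positivity
    constructor <;> linarith [h1.1, h1.2]

end Potentials

end Growth

section Sizes

variable {d N : ℕ}

/-- The total distance of the particles from the origin. -/
noncomputable def size (q : Fin N → EuclideanSpace ℝ (Fin d)) : ℝ := ∑ i, ‖q i‖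

/-- The total confinement `∑ᵢ |qᵢ|^(lam + 1)`. -/
noncomputable def mom (lam : ℝ) (q : Fin N → EuclideanSpace ℝ (Fin d)) : ℝ :=
  ∑ i, ‖q i‖ ^ (lam + 1)

/-- The total repulsion `∑_{i<j} |qᵢ - qⱼ|^(-s)`. -/
noncomputable def rep (s : ℝ) (q : Fin N → EuclideanSpace ℝ (Fin d)) : ℝ :=
  ∑ x ∈ pairs N, ‖q x.1 - q x.2‖ ^ (-s)

/-- The total kinetic energy. -/
noncomputable def kinSum (ε : ℝ) (p : Fin N → EuclideanSpace ℝ (Fin d)) : ℝ := ∑ i, kin ε (p i)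

variable {ε lam s : ℝ} {q p : Fin N → EuclideanSpace ℝ (Fin d)}

lemma size_nonneg : 0 ≤ size q := Finset.sum_nonneg fun _ _ => norm_nonneg _

lemma mom_nonneg : 0 ≤ mom lam q := Finset.sum_nonneg fun _ _ => by positivity

lemma rep_nonneg : 0 ≤ rep s q := Finset.sum_nonneg fun _ _ => by positivity

lemma kinSum_nonneg : 0 ≤ kinSum ε p := Finset.sum_nonneg fun _ _ => Real.sqrt_nonneg _

lemma norm_le_size (i : Fin N) : ‖q i‖ ≤ size q :=
  Finset.single_le_sum (f := fun i => ‖q i‖) (fun _ _ => norm_nonneg _) (Finset.mem_univ i)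

lemma norm_sub_le_size (i j : Fin N) : ‖q i - q j‖ ≤ 2 * size q := by
  have := norm_sub_le (q i) (q j)
  linarith [norm_le_size (q := q) i, norm_le_size (q := q) j]

lemma kin_le_kinSum (i : Fin N) : kin ε (p i) ≤ kinSum ε p :=
  Finset.single_le_sum (f := fun i => kin ε (p i)) (fun _ _ => Real.sqrt_nonneg _)
    (Finset.mem_univ i)

lemma sum_pairs_le {f : Fin N × Fin N → ℝ} {C : ℝ} (hC : 0 ≤ C) (h : ∀ x ∈ pairs N, f x ≤ C) :
    ∑ x ∈ pairs N, f x ≤ (N : ℝ) ^ 2 * C := by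
  refine (Finset.sum_le_card_nsmul _ _ _ h).trans ?_
  rw [nsmul_eq_mul]
  exact mul_le_mul_of_nonneg_right card_pairs_le hC

lemma le_small_rpow {t δ lam : ℝ} (ht : 0 ≤ t) (hδ : 0 < δ) (hlam : 1 ≤ lam) :
    t ≤ δ * t ^ (lam + 1) + (δ + 1 / (4 * δ)) := by
  have h1 : t ^ 2 ≤ 1 + t ^ (lam + 1) := by
    rcases le_total t 1 with h | h
    · have : t ^ 2 ≤ 1 := by nlinarith
      have h2 : 0 ≤ t ^ (lam + 1) := by positivity
      linarith
    · have h2 := Real.rpow_le_rpow_of_exponent_le h (show (2 : ℝ) ≤ lam + 1 by linarith)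
      rw [Real.rpow_ofNat] at h2
      linarith
  have h2 : t ≤ δ * t ^ 2 + 1 / (4 * δ) := by
    have h3 : 0 ≤ (2 * δ * t - 1) ^ 2 / (4 * δ) := by positivity
    have h4 : (2 * δ * t - 1) ^ 2 / (4 * δ) = δ * t ^ 2 + 1 / (4 * δ) - t := by
      field_simp
      ring
    linarith
  nlinarith

lemma exists_size_le_mom (N : ℕ) (hlam : 1 ≤ lam) {δ : ℝ} (hδ : 0 < δ) :
    ∃ C : ℝ, 0 < C ∧ ∀ q : Fin N → EuclideanSpace ℝ (Fin d), size q ≤ δ * mom lam q + C := by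
  refine ⟨N * (δ + 1 / (4 * δ)) + 1, by positivity, fun q => ?_⟩
  have h : size q ≤ ∑ i, (δ * ‖q i‖ ^ (lam + 1) + (δ + 1 / (4 * δ))) :=
    Finset.sum_le_sum fun i _ => le_small_rpow (norm_nonneg _) hδ hlam
  rw [Finset.sum_add_distrib, ← Finset.mul_sum] at h
  simp only [Finset.sum_const, Finset.card_univ, Fintype.card_fin, nsmul_eq_mul] at h
  unfold mom
  linarith

variable {U G : EuclideanSpace ℝ (Fin d) → ℝ} {a₁ a₂ a₃ β₂ a₄ a₅ a₆ : ℝ}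

namespace Potentials

lemma exists_HN_le (h : Potentials U G a₁ lam a₂ a₃ s β₂ a₄ a₅ a₆) (N : ℕ) :
    ∃ C : ℝ, 0 < C ∧ ∀ ε ∈ Set.Ioo (0 : ℝ) 1, ∀ q p : Fin N → EuclideanSpace ℝ (Fin d),
      Function.Injective q →
      HN ε U G q p ≤ C * (ε * (mom lam q + rep s q)) + C + kinSum ε p := by
  obtain ⟨c₀, C₀, hc₀, hC₀, hG⟩ := h.exists_G_bounds
  obtain ⟨D, hD, hsize⟩ := exists_size_le_mom (d := d) N h.one_le_lam one_pos
  have ha₁ := h.a₁_pos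
  set C : ℝ := a₁ + 2 * N ^ 2 * C₀ + C₀ + N * a₁ + N ^ 2 * C₀ * (1 + 2 * D) with hC
  refine ⟨C, by positivity, fun ε hε q p hq => ?_⟩
  have hQ := mom_nonneg (lam := lam) (q := q)
  have hR := rep_nonneg (s := s) (q := q)
  have h1 : ∑ i, U (q i) ≤ N * a₁ + a₁ * mom lam q := by
    refine (Finset.sum_le_sum fun i _ => h.U_up (q i)).trans (le_of_eq ?_)
    simp only [mul_add, Finset.sum_add_distrib, ← Finset.mul_sum, mom]
    simp
    ring
  have h2 : ∑ x ∈ pairs N, G (q x.1 - q x.2)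
      ≤ N ^ 2 * (C₀ * (1 + 2 * size q)) + C₀ * rep s q := by
    have h3 : ∑ x ∈ pairs N, G (q x.1 - q x.2) ≤ ∑ x ∈ pairs N,
        (C₀ * (1 + ‖q x.1 - q x.2‖) + C₀ * ‖q x.1 - q x.2‖ ^ (-s)) :=
      Finset.sum_le_sum fun x hx => by
        have := (hG _ (sub_ne_zero_of_mem_pairs hq hx)).2
        linarith
    rw [Finset.sum_add_distrib, ← Finset.mul_sum (pairs N) (fun x => ‖q x.1 - q x.2‖ ^ (-s))] at h3
    have h4 := sum_pairs_le (f := fun x => C₀ * (1 + ‖q x.1 - q x.2‖)) (C := C₀ * (1 + 2 * size q))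
      (by have := size_nonneg (q := q); positivity)
      (fun x _ => by gcongr; exact norm_sub_le_size x.1 x.2)
    unfold rep
    linarith
  have h5 : pot U G q ≤ C * (mom lam q + rep s q) + C := by
    have h6 : (N : ℝ) ^ 2 * C₀ * size q ≤ N ^ 2 * C₀ * (mom lam q + D) := by
      gcongr; linarith [hsize q]
    have h7 : 0 ≤ (C - C₀) * rep s q := mul_nonneg (by rw [hC]; ring_nf; positivity) hR
    have h8 : 0 ≤ (C - (a₁ + 2 * N ^ 2 * C₀)) * mom lam q :=
      mul_nonneg (by rw [hC]; ring_nf; positivity) hQ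
    have h9 : 0 ≤ C - (N * a₁ + N ^ 2 * C₀ * (1 + 2 * D)) := by rw [hC]; ring_nf; positivity
    unfold pot
    linarith
  have h6 : ε * pot U G q ≤ ε * (C * (mom lam q + rep s q) + C) := by
    gcongr
    exact hε.1.le
  have h7 : ε * C ≤ C := by
    have : 0 < C := by positivity
    nlinarith [hε.2]
  rw [HN_eq]
  unfold kinSum
  linarith

lemma exists_le_HN (h : Potentials U G a₁ lam a₂ a₃ s β₂ a₄ a₅ a₆) (N : ℕ) :
    ∃ C : ℝ, 0 < C ∧ ∀ ε ∈ Set.Ioo (0 : ℝ) 1, ∀ q p : Fin N → EuclideanSpace ℝ (Fin d),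
      Function.Injective q → 1 ≤ HN ε U G q p →
      ε * (mom lam q + rep s q) ≤ C * HN ε U G q p := by
  obtain ⟨c₀, C₀, hc₀, hC₀, hG⟩ := h.exists_G_bounds
  have ha₁ := h.a₁_pos
  set δ : ℝ := 1 / (2 * a₁) / (2 * N ^ 2 * C₀ + 1) with hδ
  have hδ0 : 0 < δ := by positivity
  have hδ1 : 2 * N ^ 2 * C₀ * δ ≤ 1 / (2 * a₁) := by
    have : δ * (2 * N ^ 2 * C₀ + 1) = 1 / (2 * a₁) := by rw [hδ]; field_simp
    linarith
  obtain ⟨D, hD, hsize⟩ := exists_size_le_mom (d := d) N h.one_le_lam hδ0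
  set B : ℝ := N * a₁ + N ^ 2 * C₀ * (1 + 2 * D) with hB
  set c : ℝ := min (1 / (2 * a₁)) c₀ with hc
  have hc0 : 0 < c := lt_min (by positivity) hc₀
  have hB0 : 0 ≤ B := by positivity
  refine ⟨(1 + B) / c, by positivity, fun ε hε q p hq hH => ?_⟩
  have hQ := mom_nonneg (lam := lam) (q := q)
  have hR := rep_nonneg (s := s) (q := q)
  have h1 : 1 / a₁ * mom lam q - N * a₁ ≤ ∑ i, U (q i) := by
    refine (le_of_eq ?_).trans (Finset.sum_le_sum fun i _ => h.U_low (q i))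
    simp only [Finset.sum_sub_distrib, ← Finset.mul_sum, mom]
    simp
  have h2 : c₀ * rep s q - N ^ 2 * (C₀ * (1 + 2 * size q))
      ≤ ∑ x ∈ pairs N, G (q x.1 - q x.2) := by
    have h3 : ∑ x ∈ pairs N, (c₀ * ‖q x.1 - q x.2‖ ^ (-s) - C₀ * (1 + ‖q x.1 - q x.2‖))
        ≤ ∑ x ∈ pairs N, G (q x.1 - q x.2) :=
      Finset.sum_le_sum fun x hx => (hG _ (sub_ne_zero_of_mem_pairs hq hx)).1
    rw [Finset.sum_sub_distrib, ← Finset.mul_sum (pairs N) (fun x => ‖q x.1 - q x.2‖ ^ (-s))] at h3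
    have h4 := sum_pairs_le (f := fun x => C₀ * (1 + ‖q x.1 - q x.2‖)) (C := C₀ * (1 + 2 * size q))
      (by have := size_nonneg (q := q); positivity)
      (fun x _ => by gcongr; exact norm_sub_le_size x.1 x.2)
    unfold rep
    linarith
  have h5 : c * (mom lam q + rep s q) - B ≤ pot U G q := by
    have h6 : (N : ℝ) ^ 2 * C₀ * size q ≤ N ^ 2 * C₀ * (δ * mom lam q + D) := by
      gcongr; exact hsize q
    have h7 : c * rep s q ≤ c₀ * rep s q := by gcongr; exact min_le_right _ _
    have h8 : c * mom lam q ≤ 1 / (2 * a₁) * mom lam q := by gcongr; exact min_le_left _ _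
    have h9 : 2 * N ^ 2 * C₀ * δ * mom lam q ≤ 1 / (2 * a₁) * mom lam q := by gcongr
    have h10 : 1 / a₁ * mom lam q = 1 / (2 * a₁) * mom lam q + 1 / (2 * a₁) * mom lam q := by
      field_simp; ring
    unfold pot
    linarith
  have h6 : ε * (c * (mom lam q + rep s q) - B) ≤ ε * pot U G q :=
    mul_le_mul_of_nonneg_left h5 hε.1.le
  have h7 : ε * B ≤ B := by nlinarith [hε.2]
  have h8 : ε * pot U G q ≤ HN ε U G q p := by
    rw [HN_eq]
    have := kinSum_nonneg (ε := ε) (p := p)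
    unfold kinSum at this
    linarith
  rw [div_mul_eq_mul_div, le_div_iff₀ hc0]
  nlinarith

end Potentials

lemma kinSum_le_HN (hε : 0 < ε) (hn : 1 ≤ pot U G q) : kinSum ε p ≤ HN ε U G q p := by
  rw [HN_eq]
  unfold kinSum
  nlinarith

lemma one_le_kinSum (hε : 0 < ε) (hN : 2 ≤ N) : 1 ≤ kinSum ε p :=
  (one_le_kin hε (p ⟨0, by omega⟩)).trans (kin_le_kinSum _)

end Sizes

section Drift

variable {d N : ℕ} {ε lam s : ℝ} {q p : Fin N → EuclideanSpace ℝ (Fin d)}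
  {U G : EuclideanSpace ℝ (Fin d) → ℝ} {a₁ a₂ a₃ β₂ a₄ a₅ a₆ : ℝ}

lemma sqrt_mul_norm_vel_le (hε : 0 < ε) (i : Fin N) : Real.sqrt ε * ‖vel ε p i‖ ≤ 1 := by
  have h := sqrt_mul_norm_le_kin hε (p i)
  have hk : 0 < kin ε (p i) := lt_of_lt_of_le one_pos (one_le_kin hε _)
  have h1 : ‖vel ε p i‖ = (kin ε (p i))⁻¹ * ‖p i‖ := by
    rw [vel, norm_smul, norm_inv, Real.norm_of_nonneg (Real.sqrt_nonneg _)]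
    rfl
  rw [h1, mul_left_comm, inv_mul_le_iff₀ hk, mul_one]
  exact h

lemma sqrt_mul_norm_le_kinSum (hε : 0 < ε) (i : Fin N) :
    Real.sqrt ε * ‖p i‖ ≤ kinSum ε p :=
  (sqrt_mul_norm_le_kin hε (p i)).trans (kin_le_kinSum i)

lemma le_sqrt_self (hε : ε ∈ Set.Ioo (0 : ℝ) 1) : ε ≤ Real.sqrt ε :=
  Real.le_sqrt_of_sq_le (by nlinarith [hε.1, hε.2])

lemma norm_vel_le (hε : ε ∈ Set.Ioo (0 : ℝ) 1) (i : Fin N) : ‖vel ε p i‖ ≤ 1 / ε := by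
  rw [le_div_iff₀ hε.1]
  have h1 := sqrt_mul_norm_vel_le (p := p) hε.1 i
  nlinarith [le_sqrt_self hε, norm_nonneg (vel ε p i)]

lemma norm_le_kinSum_div (hε : ε ∈ Set.Ioo (0 : ℝ) 1) (i : Fin N) :
    ‖p i‖ ≤ kinSum ε p / ε := by
  rw [le_div_iff₀ hε.1]
  have h1 := sqrt_mul_norm_le_kinSum (p := p) hε.1 i
  nlinarith [le_sqrt_self hε, norm_nonneg (p i)]

lemma mul_norm_vel_sq_le (hε : 0 < ε) (i : Fin N) : ε * ‖vel ε p i‖ ^ 2 ≤ 1 := by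
  have h := sqrt_mul_norm_vel_le (p := p) hε i
  have h0 : 0 ≤ Real.sqrt ε * ‖vel ε p i‖ := by positivity
  have h1 : ε * ‖vel ε p i‖ ^ 2 = (Real.sqrt ε * ‖vel ε p i‖) ^ 2 := by
    rw [mul_pow, Real.sq_sqrt hε.le]
  rw [h1]
  exact pow_le_one₀ h0 h

lemma half_le_mul_norm_vel_sq (hε : 0 < ε) {i : Fin N} (hi : 1 ≤ ε * ‖p i‖ ^ 2) :
    1 / 2 ≤ ε * ‖vel ε p i‖ ^ 2 := by
  have hk : 0 < kin ε (p i) := lt_of_lt_of_le one_pos (one_le_kin hε _)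
  have h1 : ‖vel ε p i‖ = (kin ε (p i))⁻¹ * ‖p i‖ := by
    rw [vel, norm_smul, norm_inv, Real.norm_of_nonneg (Real.sqrt_nonneg _)]
    rfl
  have h2 : ε * ‖vel ε p i‖ ^ 2 = ε * ‖p i‖ ^ 2 / (1 + ε * ‖p i‖ ^ 2) := by
    rw [h1, ← kin_sq hε]
    field_simp
  rw [h2, div_le_div_iff₀ (by norm_num) (by positivity)]
  linarith

lemma kinSum_le_of_small (hε : 0 < ε) (h : ∀ i, ε * ‖p i‖ ^ 2 ≤ 1) : kinSum ε p ≤ 2 * N := by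
  have h1 : kinSum ε p ≤ ∑ _i : Fin N, (2 : ℝ) := by
    refine Finset.sum_le_sum fun i _ => ?_
    have h2 := kin_sq hε (p i)
    have h3 := one_le_kin hε (p i)
    nlinarith [h i]
  simpa [mul_comm] using h1

lemma sum_secondDeriv_HN_mem (hε : 0 < ε) :
    ∑ i, ∑ α, secondDeriv (HN ε U G q) p (dir i α) ∈ Set.Icc 0 (ε * (N * d)) := by
  constructor
  · exact Finset.sum_nonneg fun i _ => Finset.sum_nonneg fun α _ => (secondDeriv_HN_mem hε i α).1
  · refine (Finset.sum_le_sum fun i _ => Finset.sum_le_sum fun α _ =>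
      (secondDeriv_HN_mem hε i α).2).trans (le_of_eq ?_)
    simp
    ring

lemma abs_fderiv_HN_dir_le (hε : ε ∈ Set.Ioo (0 : ℝ) 1) (i : Fin N) (α : Fin d) :
    |fderiv ℝ (HN ε U G q) p (dir i α)| ≤ 1 := by
  rw [fderiv_HN_momentum hε.1, inner_dir, abs_mul, abs_of_pos hε.1]
  have h := abs_real_inner_le_norm (vel ε p i) (EuclideanSpace.single α (1 : ℝ))
  have h2 := norm_vel_le (p := p) hε i
  rw [le_div_iff₀ hε.1] at h2
  simp only [PiLp.norm_single, norm_one, mul_one] at h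
  nlinarith [hε.1]

lemma abs_fderiv_virial_dir_le (i : Fin N) (α : Fin d) :
    |fderiv ℝ (virial q) p (dir i α)| ≤ size q := by
  rw [fderiv_virial_momentum, inner_dir]
  have h := abs_real_inner_le_norm (q i) (EuclideanSpace.single α (1 : ℝ))
  simp only [PiLp.norm_single, norm_one, mul_one] at h
  exact h.trans (norm_le_size i)

lemma abs_sum_pairs_inner_sing_le (hs0 : 0 ≤ s) (hs1 : s ≤ 1)
    {u : Fin N → EuclideanSpace ℝ (Fin d)} {C : ℝ} (hC : 0 ≤ C) (hu : ∀ i, ‖u i‖ ≤ C) :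
    |∑ x ∈ pairs N, ⟪sing s (q x.1 - q x.2), u x.1 - u x.2⟫|
      ≤ 4 * N ^ 2 * ((1 + size q) * C) := by
  have hS := size_nonneg (q := q)
  have h := sum_pairs_le
    (f := fun x => |⟪sing s (q x.1 - q x.2), u x.1 - u x.2⟫|)
    (C := 4 * ((1 + size q) * C)) (by positivity) (fun x _ => by
      refine (abs_real_inner_le_norm _ _).trans ?_
      have h1 := norm_sing_le hs0 hs1 (q x.1 - q x.2)
      have h2 := norm_sub_le_size (q := q) x.1 x.2
      have h3 : ‖u x.1 - u x.2‖ ≤ 2 * C := by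
        linarith [norm_sub_le (u x.1) (u x.2), hu x.1, hu x.2]
      calc ‖sing s (q x.1 - q x.2)‖ * ‖u x.1 - u x.2‖
          ≤ (2 * (1 + size q)) * (2 * C) := by gcongr; linarith
        _ = 4 * ((1 + size q) * C) := by ring)
  refine (Finset.abs_sum_le_sum_abs _ _).trans (h.trans (le_of_eq (by ring)))

lemma norm_dir_le (i j : Fin N) (α : Fin d) :
    ‖(dir i α : Fin N → EuclideanSpace ℝ (Fin d)) j‖ ≤ 1 := by
  by_cases h : j = i
  · subst h; simp [dir]
  · simp [dir, h]

lemma abs_fderiv_corr_dir_le (hs0 : 0 ≤ s) (hs1 : s ≤ 1) (i : Fin N) (α : Fin d) :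
    |fderiv ℝ (corr s q) p (dir i α)| ≤ 4 * N ^ 2 * (1 + size q) := by
  rw [fderiv_corr_momentum]
  have := abs_sum_pairs_inner_sing_le (q := q) hs0 hs1 zero_le_one
    (fun j => norm_dir_le i j α)
  rwa [mul_one] at this

lemma abs_corr_le (hε : ε ∈ Set.Ioo (0 : ℝ) 1) (hs0 : 0 ≤ s) (hs1 : s ≤ 1) :
    |corr s q p| ≤ 4 * N ^ 2 * ((1 + size q) * (kinSum ε p / ε)) :=
  abs_sum_pairs_inner_sing_le hs0 hs1 (div_nonneg kinSum_nonneg hε.1.le)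
    (fun i => norm_le_kinSum_div hε i)

lemma abs_virial_le (hε : ε ∈ Set.Ioo (0 : ℝ) 1) :
    |virial q p| ≤ size q * (kinSum ε p / ε) := by
  refine (Finset.abs_sum_le_sum_abs _ _).trans ?_
  rw [size, Finset.sum_mul]
  refine Finset.sum_le_sum fun i _ => (abs_real_inner_le_norm _ _).trans ?_
  gcongr
  exact norm_le_kinSum_div hε i

lemma rpow_le_rep {i j : Fin N} (hij : i ≠ j) : ‖q i - q j‖ ^ (-s) ≤ rep s q := by
  have h : ∀ x ∈ pairs N, ‖q x.1 - q x.2‖ ^ (-s) ≤ rep s q := fun x hx =>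
    Finset.single_le_sum (f := fun x : Fin N × Fin N => ‖q x.1 - q x.2‖ ^ (-s))
      (fun _ _ => by positivity) hx
  rcases lt_or_gt_of_ne hij with h1 | h1
  · exact h (i, j) (by simpa [pairs] using h1)
  · rw [norm_sub_rev]
    exact h (j, i) (by simpa [pairs] using h1)

/-- The total field `∑_{j ≠ i} (qᵢ - qⱼ) / |qᵢ - qⱼ|^t` on each particle. -/
noncomputable def field (t : ℝ) (q : Fin N → EuclideanSpace ℝ (Fin d)) :
    Fin N → EuclideanSpace ℝ (Fin d) :=
  fun i => ∑ j ∈ Finset.univ.filter (fun j => j ≠ i), sing t (q i - q j)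

lemma field_eq_sum (t : ℝ) (q : Fin N → EuclideanSpace ℝ (Fin d)) (i : Fin N) :
    field t q i = ∑ j, sing t (q i - q j) := by
  rw [field, Finset.sum_filter]
  refine Finset.sum_congr rfl fun j _ => ?_
  split_ifs with h
  · rfl
  · have : j = i := by simpa using h
    subst this
    simp [sing_zero]

lemma sum_inner_field (t : ℝ) (q u : Fin N → EuclideanSpace ℝ (Fin d)) :
    ∑ i, ⟪field t q i, u i⟫ = ∑ x ∈ pairs N, ⟪sing t (q x.1 - q x.2), u x.1 - u x.2⟫ :=
  sum_inner_sum_ne_eq_sum_pairs (A := fun i j => sing t (q i - q j))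
    (fun i j _ => by rw [← neg_sub, sing_neg]) u

/-- Monotonicity of the corrector field gives the coercivity of its pairing with the leading
part of the interaction force. -/
lemma sum_sq_le_sum_pairs_inner_field (hs1 : s ≤ 1) (hq : Function.Injective q) :
    ∑ x ∈ pairs N, (‖q x.1 - q x.2‖ ^ (-s)) ^ 2
      ≤ ∑ x ∈ pairs N,
        ⟪sing s (q x.1 - q x.2), field (s + 2) q x.1 - field (s + 2) q x.2⟫ := by
  rw [← sum_inner_field]
  simp_rw [fun i => real_inner_comm (field (s + 2) q i) (field s q i)]
  rw [sum_inner_field]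
  refine Finset.sum_le_sum fun x hx => ?_
  have hr := sub_ne_zero_of_mem_pairs hq hx
  have hr0 : 0 < ‖q x.1 - q x.2‖ := norm_pos_iff.mpr hr
  have h1 : ‖q x.1 - q x.2‖ ^ (2 - s) ≤ ⟪q x.1 - q x.2, field s q x.1 - field s q x.2⟫ := by
    rw [field_eq_sum, field_eq_sum, ← Finset.sum_sub_distrib, inner_sum]
    have h2 : ∀ k ∈ (Finset.univ : Finset (Fin N)),
        0 ≤ ⟪q x.1 - q x.2, sing s (q x.1 - q k) - sing s (q x.2 - q k)⟫ := fun k _ => by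
      have := inner_sub_sing_sub_nonneg hs1 (q x.1 - q k) (q x.2 - q k)
      rwa [sub_sub_sub_cancel_right] at this
    refine le_trans (le_of_eq ?_) (Finset.single_le_sum h2 (Finset.mem_univ x.2))
    rw [sub_self, sing_zero, sub_zero, inner_self_sing hr]
  rw [sing, real_inner_smul_left]
  refine le_trans (le_of_eq ?_) (mul_le_mul_of_nonneg_left h1 (by positivity))
  rw [← Real.rpow_neg hr0.le, ← Real.rpow_add hr0, ← Real.rpow_natCast, ← Real.rpow_mul hr0.le]
  congr 1
  push_cast
  ring

lemma rep_sq_le (s : ℝ) (q : Fin N → EuclideanSpace ℝ (Fin d)) :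
    rep s q ^ 2 ≤ N ^ 2 * ∑ x ∈ pairs N, (‖q x.1 - q x.2‖ ^ (-s)) ^ 2 := by
  refine sq_sum_le_card_mul_sum_sq.trans ?_
  exact mul_le_mul_of_nonneg_right card_pairs_le (Finset.sum_nonneg fun _ _ => sq_nonneg _)

namespace Potentials

lemma LN_HN_eq (h : Potentials U G a₁ lam a₂ a₃ s β₂ a₄ a₅ a₆) (hε : 0 < ε)
    (hq : Function.Injective q) :
    LN ε U G (HN ε U G) q p = -ε * ∑ i, ‖vel ε p i‖ ^ 2
      + ∑ i, ∑ α, secondDeriv (HN ε U G q) p (dir i α) :=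
  LN_HN hε h.U_diff h.G_diff h.G_odd hq

lemma LN_HN_le (h : Potentials U G a₁ lam a₂ a₃ s β₂ a₄ a₅ a₆) (hε : 0 < ε)
    (hq : Function.Injective q) : LN ε U G (HN ε U G) q p ≤ ε * (N * d) := by
  rw [h.LN_HN_eq hε hq]
  have h1 := (sum_secondDeriv_HN_mem (U := U) (G := G) (q := q) (p := p) hε).2
  have h2 : 0 ≤ ε * ∑ i, ‖vel ε p i‖ ^ 2 := by positivity
  linarith

lemma LN_HN_le_of_large (h : Potentials U G a₁ lam a₂ a₃ s β₂ a₄ a₅ a₆) (hε : 0 < ε)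
    (hq : Function.Injective q) {i : Fin N} (hi : 1 ≤ ε * ‖p i‖ ^ 2) :
    LN ε U G (HN ε U G) q p ≤ -(1 / 2) + ε * (N * d) := by
  rw [h.LN_HN_eq hε hq]
  have h1 := (sum_secondDeriv_HN_mem (U := U) (G := G) (q := q) (p := p) hε).2
  have h2 : ‖vel ε p i‖ ^ 2 ≤ ∑ i, ‖vel ε p i‖ ^ 2 :=
    Finset.single_le_sum (f := fun i => ‖vel ε p i‖ ^ 2) (fun _ _ => sq_nonneg _)
      (Finset.mem_univ i)
  have h3 := half_le_mul_norm_vel_sq hε hi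
  nlinarith

lemma abs_LN_HN_le (h : Potentials U G a₁ lam a₂ a₃ s β₂ a₄ a₅ a₆)
    (hε : ε ∈ Set.Ioo (0 : ℝ) 1) (hq : Function.Injective q) :
    |LN ε U G (HN ε U G) q p| ≤ N + N * d := by
  rw [h.LN_HN_eq hε.1 hq]
  obtain ⟨h1, h1'⟩ := sum_secondDeriv_HN_mem (U := U) (G := G) (q := q) (p := p) hε.1
  have h2 : 0 ≤ ε * ∑ i, ‖vel ε p i‖ ^ 2 := mul_nonneg hε.1.le (by positivity)
  have h3 : ε * ∑ i, ‖vel ε p i‖ ^ 2 ≤ N := by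
    rw [Finset.mul_sum]
    refine (Finset.sum_le_sum fun i _ => mul_norm_vel_sq_le hε.1 i).trans (le_of_eq (by simp))
  have h4 : (0 : ℝ) ≤ N * d := by positivity
  have h5 : ε * (N * d) ≤ N * d := mul_le_of_le_one_left h4 hε.2.le
  rw [abs_le]
  constructor <;> linarith

lemma sum_inner_interGrad (h : Potentials U G a₁ lam a₂ a₃ s β₂ a₄ a₅ a₆)
    (hq : Function.Injective q) (u : Fin N → EuclideanSpace ℝ (Fin d)) :
    ∑ i, ⟪interGrad G q i, u i⟫
      = ∑ x ∈ pairs N, ⟪gradient G (q x.1 - q x.2), u x.1 - u x.2⟫ :=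
  sum_inner_sum_ne_eq_sum_pairs (A := fun i j => gradient G (q i - q j))
    (fun i j hij => by
      rw [← neg_sub (q i) (q j)]
      exact h.G_odd _ (sub_ne_zero.mpr (hq.ne hij))) u

lemma LN_virial_le (h : Potentials U G a₁ lam a₂ a₃ s β₂ a₄ a₅ a₆)
    (hε : ε ∈ Set.Ioo (0 : ℝ) 1) (hq : Function.Injective q) :
    LN ε U G virial q p ≤ kinSum ε p / ε + size q / ε - a₂ * mom lam q + N * a₃
      + a₁ * (2 * N ^ 2 * size q + rep s q) := by
  have hS := size_nonneg (q := q)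
  have ha₁ := h.a₁_pos
  rw [LN_virial]
  have h1 : ∑ i, ⟪p i, vel ε p i⟫ ≤ kinSum ε p / ε := by
    rw [kinSum, Finset.sum_div]
    refine Finset.sum_le_sum fun i _ => ?_
    have hk : 0 < kin ε (p i) := lt_of_lt_of_le one_pos (one_le_kin hε.1 _)
    have e : ⟪p i, vel ε p i⟫ = (kin ε (p i))⁻¹ * ‖p i‖ ^ 2 := by
      rw [vel, real_inner_smul_right, real_inner_self_eq_norm_sq]
      rfl
    rw [e, le_div_iff₀ hε.1, mul_assoc, inv_mul_le_iff₀ hk, ← pow_two, kin_sq hε.1]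
    linarith
  have h2 : ∑ i, ⟪q i, force ε U G q p i⟫ = -∑ i, ⟪q i, vel ε p i⟫
      - ∑ i, ⟪gradient U (q i), q i⟫ - ∑ i, ⟪interGrad G q i, q i⟫ := by
    simp only [force, inner_sub_right, inner_neg_right, Finset.sum_sub_distrib,
      Finset.sum_neg_distrib]
    simp_rw [fun i => real_inner_comm (q i) (gradient U (q i)),
      fun i => real_inner_comm (q i) (interGrad G q i)]
  have h3 : -∑ i, ⟪q i, vel ε p i⟫ ≤ size q / ε := by
    rw [← Finset.sum_neg_distrib, size, Finset.sum_div]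
    refine Finset.sum_le_sum fun i _ => ?_
    have e1 := (abs_le.mp (abs_real_inner_le_norm (q i) (vel ε p i))).1
    have e2 : ‖q i‖ * ‖vel ε p i‖ ≤ ‖q i‖ * (1 / ε) := by gcongr; exact norm_vel_le hε i
    rw [mul_one_div] at e2
    linarith
  have h4 : a₂ * mom lam q - N * a₃ ≤ ∑ i, ⟪gradient U (q i), q i⟫ := by
    refine (le_of_eq ?_).trans (Finset.sum_le_sum fun i _ => h.U_coer (q i))
    simp only [Finset.sum_sub_distrib, ← Finset.mul_sum, mom]
    simp
  have h5 : -∑ i, ⟪interGrad G q i, q i⟫ ≤ a₁ * (2 * N ^ 2 * size q + rep s q) := by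
    rw [h.sum_inner_interGrad hq, ← Finset.sum_neg_distrib]
    have e1 : ∑ x ∈ pairs N, -⟪gradient G (q x.1 - q x.2), q x.1 - q x.2⟫
        ≤ ∑ x ∈ pairs N, (a₁ * ‖q x.1 - q x.2‖ + a₁ * ‖q x.1 - q x.2‖ ^ (-s)) := by
      refine Finset.sum_le_sum fun x hx => ?_
      have hr := sub_ne_zero_of_mem_pairs hq hx
      have hr0 : 0 < ‖q x.1 - q x.2‖ := norm_pos_iff.mpr hr
      have e2 := (abs_le.mp (abs_real_inner_le_norm (gradient G (q x.1 - q x.2))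
        (q x.1 - q x.2))).1
      have e3 := mul_le_mul_of_nonneg_right (h.G_grad _ hr) hr0.le
      have e4 : ‖q x.1 - q x.2‖ ^ (-(s + 1)) * ‖q x.1 - q x.2‖ = ‖q x.1 - q x.2‖ ^ (-s) := by
        rw [← Real.rpow_add_one hr0.ne']
        congr 1
        ring
      have e5 : a₁ * (1 + ‖q x.1 - q x.2‖ ^ (-(s + 1))) * ‖q x.1 - q x.2‖
          = a₁ * ‖q x.1 - q x.2‖
            + a₁ * (‖q x.1 - q x.2‖ ^ (-(s + 1)) * ‖q x.1 - q x.2‖) := by ring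
      rw [e5, e4] at e3
      linarith
    rw [Finset.sum_add_distrib,
      ← Finset.mul_sum (pairs N) (fun x => ‖q x.1 - q x.2‖ ^ (-s))] at e1
    have e6 := sum_pairs_le (f := fun x => a₁ * ‖q x.1 - q x.2‖) (C := a₁ * (2 * size q))
      (by positivity) (fun x _ => by gcongr; exact norm_sub_le_size x.1 x.2)
    unfold rep
    linarith
  linarith

lemma norm_interGrad_add_le (h : Potentials U G a₁ lam a₂ a₃ s β₂ a₄ a₅ a₆)
    (hq : Function.Injective q) (i : Fin N) :
    ‖interGrad G q i + a₄ • field (s + 2) q i‖ ≤ N * ((|a₅| + a₆) * (1 + rep s q)) := by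
  have ha₆ := h.a₆_pos
  have hR := rep_nonneg (s := s) (q := q)
  rw [interGrad, field, Finset.smul_sum, ← Finset.sum_add_distrib]
  refine (norm_sum_le_of_le _ (n := fun _ => (|a₅| + a₆) * (1 + rep s q)) ?_).trans ?_
  · intro j hj
    have hij : i ≠ j := by
      have := (Finset.mem_filter.mp hj).2
      exact this.symm
    have hr : q i - q j ≠ 0 := sub_ne_zero.mpr (hq.ne hij)
    have h1 := h.norm_gradient_add_le hr
    have e : a₄ • sing (s + 2) (q i - q j) = (a₄ / ‖q i - q j‖ ^ (s + 2)) • (q i - q j) := by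
      rw [sing, smul_smul, div_eq_mul_inv]
    rw [e]
    have h2 := rpow_neg_le_of_le (norm_pos_iff.mpr hr) h.β₂_nonneg h.β₂_le
    have h3 := rpow_le_rep (s := s) (q := q) hij
    have h4 : |a₅| * ‖q i - q j‖ ^ (-β₂) ≤ |a₅| * (1 + rep s q) := by gcongr; linarith
    nlinarith
  · rw [Finset.sum_const, nsmul_eq_mul]
    gcongr
    refine (Finset.card_filter_le _ _).trans ?_
    simp

lemma norm_gradient_U_le (h : Potentials U G a₁ lam a₂ a₃ s β₂ a₄ a₅ a₆) (i : Fin N) :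
    ‖gradient U (q i)‖ ≤ a₁ * (2 + mom lam q) := by
  have ha₁ := h.a₁_pos
  refine (h.U_grad (q i)).trans ?_
  have hm : ‖q i‖ ^ (lam + 1) ≤ mom lam q :=
    Finset.single_le_sum (f := fun i => ‖q i‖ ^ (lam + 1)) (fun _ _ => by positivity)
      (Finset.mem_univ i)
  have h1 : ‖q i‖ ^ lam ≤ 1 + ‖q i‖ ^ (lam + 1) := by
    rcases le_total ‖q i‖ 1 with hx | hx
    · have h2 := Real.rpow_le_one (norm_nonneg (q i)) hx (zero_le_one.trans h.one_le_lam)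
      have h3 : 0 ≤ ‖q i‖ ^ (lam + 1) := by positivity
      linarith
    · have h2 := Real.rpow_le_rpow_of_exponent_le hx (show lam ≤ lam + 1 by linarith)
      linarith
  exact mul_le_mul_of_nonneg_left (by linarith) ha₁.le

lemma le_LN_corr (h : Potentials U G a₁ lam a₂ a₃ s β₂ a₄ a₅ a₆)
    (hε : ε ∈ Set.Ioo (0 : ℝ) 1) (hq : Function.Injective q) :
    a₄ * ∑ x ∈ pairs N, (‖q x.1 - q x.2‖ ^ (-s)) ^ 2 - 8 * (kinSum ε p * rep s q / ε)
      - 4 * N ^ 2 * ((1 + size q) * (1 / ε + a₁ * (2 + mom lam q)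
        + N * ((|a₅| + a₆) * (1 + rep s q)))) ≤ LN ε U G (corr s) q p := by
  have hs0 := h.s_pos.le
  have ha₁ := h.a₁_pos
  have ha₆ := h.a₆_pos
  have hε0 := hε.1
  have hR := rep_nonneg (s := s) (q := q)
  have hQ := mom_nonneg (lam := lam) (q := q)
  have hK := kinSum_nonneg (ε := ε) (p := p)
  rw [LN_corr hs0 h.s_le_one hq]
  have h1 : -(8 * (kinSum ε p * rep s q / ε)) ≤ ∑ x ∈ pairs N,
      ⟪fderiv ℝ (sing s) (q x.1 - q x.2) (vel ε p x.1 - vel ε p x.2), p x.1 - p x.2⟫ := by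
    have e : -(8 * (kinSum ε p * rep s q / ε))
        = ∑ x ∈ pairs N, -(8 * kinSum ε p / ε * ‖q x.1 - q x.2‖ ^ (-s)) := by
      rw [Finset.sum_neg_distrib, ← Finset.mul_sum, rep]
      ring
    rw [e]
    refine Finset.sum_le_sum fun x hx => ?_
    have e1 := (abs_le.mp (abs_real_inner_le_norm
      (fderiv ℝ (sing s) (q x.1 - q x.2) (vel ε p x.1 - vel ε p x.2)) (p x.1 - p x.2))).1
    have e2 := (sing_hasFDerivAt hs0 h.s_le_one (sub_ne_zero_of_mem_pairs hq hx)).2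
      (vel ε p x.1 - vel ε p x.2)
    have hsq : 0 < Real.sqrt ε := Real.sqrt_pos.mpr hε0
    have e3 : ‖vel ε p x.1 - vel ε p x.2‖ ≤ 2 / Real.sqrt ε := by
      rw [le_div_iff₀ hsq]
      have := norm_sub_le (vel ε p x.1) (vel ε p x.2)
      nlinarith [sqrt_mul_norm_vel_le (p := p) hε0 x.1, sqrt_mul_norm_vel_le (p := p) hε0 x.2]
    have e4 : ‖p x.1 - p x.2‖ ≤ 2 * kinSum ε p / Real.sqrt ε := by
      rw [le_div_iff₀ hsq]
      have := norm_sub_le (p x.1) (p x.2)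
      nlinarith [sqrt_mul_norm_le_kinSum (p := p) hε0 x.1,
        sqrt_mul_norm_le_kinSum (p := p) hε0 x.2]
    have e5 : ‖fderiv ℝ (sing s) (q x.1 - q x.2) (vel ε p x.1 - vel ε p x.2)‖ * ‖p x.1 - p x.2‖
        ≤ 2 * ‖q x.1 - q x.2‖ ^ (-s) * (2 / Real.sqrt ε) * (2 * kinSum ε p / Real.sqrt ε) := by
      gcongr
      exact e2.trans (by gcongr)
    have e6 : 2 * ‖q x.1 - q x.2‖ ^ (-s) * (2 / Real.sqrt ε) * (2 * kinSum ε p / Real.sqrt ε)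
        = 8 * kinSum ε p / ε * ‖q x.1 - q x.2‖ ^ (-s) := by
      have e7 : 2 * ‖q x.1 - q x.2‖ ^ (-s) * (2 / Real.sqrt ε) * (2 * kinSum ε p / Real.sqrt ε)
          = 8 * kinSum ε p / (Real.sqrt ε * Real.sqrt ε) * ‖q x.1 - q x.2‖ ^ (-s) := by
        rw [mul_assoc, div_mul_div_comm]
        ring
      rw [e7, Real.mul_self_sqrt hε0.le]
    linarith
  have h2 := sum_sq_le_sum_pairs_inner_field h.s_le_one hq
  set w : Fin N → EuclideanSpace ℝ (Fin d) := fun i =>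
    -(vel ε p i) - gradient U (q i) - (interGrad G q i + a₄ • field (s + 2) q i) with hw
  have hwn : ∀ i, ‖w i‖ ≤ 1 / ε + a₁ * (2 + mom lam q)
      + N * ((|a₅| + a₆) * (1 + rep s q)) := fun i => by
    have e1 := norm_sub_le (-(vel ε p i) - gradient U (q i))
      (interGrad G q i + a₄ • field (s + 2) q i)
    have e2 := norm_sub_le (-(vel ε p i)) (gradient U (q i))
    rw [norm_neg] at e2
    linarith [norm_vel_le (p := p) hε i, h.norm_gradient_U_le (q := q) i,
      h.norm_interGrad_add_le hq i]
  have h3 := (abs_le.mp (abs_sum_pairs_inner_sing_le (q := q) hs0 h.s_le_one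
    (by positivity) hwn)).1
  have h4 : ∑ x ∈ pairs N, ⟪sing s (q x.1 - q x.2), force ε U G q p x.1 - force ε U G q p x.2⟫
      = ∑ x ∈ pairs N, ⟪sing s (q x.1 - q x.2), w x.1 - w x.2⟫
        + a₄ * ∑ x ∈ pairs N,
          ⟪sing s (q x.1 - q x.2), field (s + 2) q x.1 - field (s + 2) q x.2⟫ := by
    rw [Finset.mul_sum, ← Finset.sum_add_distrib]
    refine Finset.sum_congr rfl fun x _ => ?_
    rw [← real_inner_smul_right, ← inner_add_right]
    congr 1
    simp only [force, hw]
    module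
  rw [h4]
  nlinarith [mul_le_mul_of_nonneg_left h2 h.a₄_pos.le]

end Potentials

end Drift

section Lyapunov

variable {d N : ℕ} {ε lam s A₁ A₂ κ : ℝ} {q p : Fin N → EuclideanSpace ℝ (Fin d)}
  {U G : EuclideanSpace ℝ (Fin d) → ℝ} {a₁ a₂ a₃ β₂ a₄ a₅ a₆ : ℝ}

/-- The Lyapunov candidate in terms of the virial and the corrector. -/
noncomputable def lyapunov (ε s A₁ A₂ κ : ℝ) (U G : EuclideanSpace ℝ (Fin d) → ℝ)
    (q p : Fin N → EuclideanSpace ℝ (Fin d)) : ℝ :=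
  A₁ * HN ε U G q p ^ 3 + ε * (HN ε U G q p * virial q p) + (-(A₂ * ε ^ 2)) * corr s q p + κ

lemma abs_carre_le
    {φ ψ : (Fin N → EuclideanSpace ℝ (Fin d)) → (Fin N → EuclideanSpace ℝ (Fin d)) → ℝ}
    {a b : ℝ} (ha : ∀ i α, |fderiv ℝ (φ q) p (dir i α)| ≤ a)
    (hb : ∀ i α, |fderiv ℝ (ψ q) p (dir i α)| ≤ b) :
    |carre φ ψ q p| ≤ N * d * (a * b) := by
  have h : ∀ i : Fin N, |∑ α : Fin d, fderiv ℝ (φ q) p (dir i α) * fderiv ℝ (ψ q) p (dir i α)|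
      ≤ ∑ _α : Fin d, a * b := fun i => by
    refine (Finset.abs_sum_le_sum_abs _ _).trans (Finset.sum_le_sum fun α _ => ?_)
    rw [abs_mul]
    exact mul_le_mul (ha i α) (hb i α) (abs_nonneg _) ((abs_nonneg _).trans (ha i α))
  refine (Finset.abs_sum_le_sum_abs _ _).trans
    ((Finset.sum_le_sum fun i _ => h i).trans (le_of_eq ?_))
  simp [mul_assoc]

lemma drift_le_of_bounds {H K S LH LS LW cHH cHS σ Q R P A₁ A₂ ε a₁ a₂ a₃ a₄ b B n m : ℝ}
    (hε : ε ∈ Set.Ioo (0 : ℝ) 1) (hA₁ : 0 < A₁) (hA₂ : 0 < A₂) (ha₁ : 0 < a₁) (ha₃ : 0 < a₃)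
    (ha₄ : 0 < a₄) (hb : 0 ≤ b) (hB : 0 < B) (hn : 1 ≤ n) (hm : 0 ≤ m) (hH : 1 ≤ H)
    (hK : 0 ≤ K) (hKH : K ≤ H) (hσ : 0 ≤ σ) (hQ : Q ≤ B * H) (hR : R ≤ B * H)
    (hHH : |cHH| ≤ m) (hHS : |cHS| ≤ m * σ) (hS : |S| ≤ σ * (K / ε)) (hLH : |LH| ≤ n + m)
    (hLS : LS ≤ K / ε + σ / ε - a₂ * Q + n * a₃ + a₁ * (2 * n ^ 2 * σ + R))
    (hLW : a₄ * P - 8 * (K * R / ε)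
      - 4 * n ^ 2 * ((1 + σ) * (1 / ε + a₁ * (2 + Q) + n * (b * (1 + R)))) ≤ LW)
    (hP : R ^ 2 ≤ n ^ 2 * P) :
    A₁ * (3 * H ^ 2 * LH + 6 * H * cHH) + ε * (H * LS + S * LH + 2 * cHS) + -(A₂ * ε ^ 2) * LW
      ≤ 3 * A₁ * H ^ 2 * LH + H * K - ε * a₂ * H * Q + ε * a₁ * H * R + 8 * A₂ * ε * K * R
        - A₂ * ε ^ 2 * (a₄ / n ^ 2) * R ^ 2
        + (6 * A₁ * m + 1 + n * a₃ + 2 * a₁ * n ^ 2 + (n + m) + 2 * m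
          + 4 * A₂ * n ^ 2 * (1 / ε + a₁ * (2 + B) + n * (b * (1 + B)))) * ((1 + σ) * H) := by
  obtain ⟨hε0, hε1⟩ := hε
  have hσH : 0 ≤ σ * H := by positivity
  have hT1 : H ≤ (1 + σ) * H := by nlinarith
  have hT2 : σ * H ≤ (1 + σ) * H := by nlinarith
  have hT3 : σ ≤ (1 + σ) * H := by nlinarith
  have hn0 : 0 < n := by linarith
  have h1 : A₁ * (6 * H * cHH) ≤ 6 * A₁ * m * ((1 + σ) * H) := by
    calc A₁ * (6 * H * cHH) ≤ A₁ * (6 * H * m) := by gcongr; exact (le_abs_self _).trans hHH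
      _ = 6 * A₁ * m * H := by ring
      _ ≤ _ := by gcongr
  have h2 : ε * (H * LS) ≤ H * K - ε * a₂ * H * Q + ε * a₁ * H * R
      + (1 + n * a₃ + 2 * a₁ * n ^ 2) * ((1 + σ) * H) := by
    have e1 : ε * (H * LS) ≤ ε * (H * (K / ε + σ / ε - a₂ * Q + n * a₃
        + a₁ * (2 * n ^ 2 * σ + R))) := by gcongr
    have e2 : ε * (H * (K / ε + σ / ε - a₂ * Q + n * a₃ + a₁ * (2 * n ^ 2 * σ + R)))
        = H * K - ε * a₂ * H * Q + ε * a₁ * H * R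
          + (σ * H + ε * (n * a₃ * H) + ε * (2 * a₁ * n ^ 2 * (σ * H))) := by
      field_simp
      ring
    have e3 : ε * (n * a₃ * H) ≤ n * a₃ * ((1 + σ) * H) :=
      (mul_le_of_le_one_left (by positivity) hε1.le).trans (by gcongr)
    have e4 : ε * (2 * a₁ * n ^ 2 * (σ * H)) ≤ 2 * a₁ * n ^ 2 * ((1 + σ) * H) :=
      (mul_le_of_le_one_left (by positivity) hε1.le).trans (by gcongr)
    linarith
  have h3 : ε * (S * LH) ≤ (n + m) * ((1 + σ) * H) := by
    have e1 : S * LH ≤ σ * (K / ε) * (n + m) := by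
      refine (le_abs_self _).trans ?_
      rw [abs_mul]
      exact mul_le_mul hS hLH (abs_nonneg _) (by positivity)
    have e2 : ε * (σ * (K / ε) * (n + m)) = (n + m) * (σ * K) := by field_simp
    calc ε * (S * LH) ≤ ε * (σ * (K / ε) * (n + m)) := by gcongr
      _ = (n + m) * (σ * K) := e2
      _ ≤ (n + m) * (σ * H) := by gcongr
      _ ≤ _ := by gcongr
  have h4 : ε * (2 * cHS) ≤ 2 * m * ((1 + σ) * H) := by
    have e1 : cHS ≤ m * σ := (le_abs_self _).trans hHS
    calc ε * (2 * cHS) ≤ ε * (2 * (m * σ)) := by gcongr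
      _ ≤ 2 * (m * σ) := mul_le_of_le_one_left (by positivity) hε1.le
      _ = 2 * m * σ := by ring
      _ ≤ _ := by gcongr
  have h5 : -(A₂ * ε ^ 2) * LW ≤ 8 * A₂ * ε * K * R - A₂ * ε ^ 2 * (a₄ / n ^ 2) * R ^ 2
      + 4 * A₂ * n ^ 2 * (1 / ε + a₁ * (2 + B) + n * (b * (1 + B))) * ((1 + σ) * H) := by
    have e0 : a₄ / n ^ 2 * R ^ 2 ≤ a₄ * P := by
      rw [div_mul_eq_mul_div, div_le_iff₀ (by positivity)]
      linarith [mul_le_mul_of_nonneg_left hP ha₄.le]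
    have e1 : (1 + σ) * (1 / ε + a₁ * (2 + Q) + n * (b * (1 + R)))
        ≤ (1 / ε + a₁ * (2 + B) + n * (b * (1 + B))) * ((1 + σ) * H) := by
      have f1 : 1 / ε ≤ 1 / ε * H := le_mul_of_one_le_right (by positivity) hH
      have f2 : a₁ * (2 + Q) ≤ a₁ * ((2 + B) * H) := by gcongr; linarith
      have f3 : n * (b * (1 + R)) ≤ n * (b * ((1 + B) * H)) := by gcongr; linarith
      calc _ ≤ (1 + σ) * (1 / ε * H + a₁ * ((2 + B) * H) + n * (b * ((1 + B) * H))) := by gcongr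
        _ = _ := by ring
    set X : ℝ := (1 / ε + a₁ * (2 + B) + n * (b * (1 + B))) * ((1 + σ) * H) with hX
    have hX0 : 0 ≤ X := by positivity
    have e2 : a₄ / n ^ 2 * R ^ 2 - 8 * (K * R / ε) - 4 * n ^ 2 * X ≤ LW := by
      have : 4 * n ^ 2 * ((1 + σ) * (1 / ε + a₁ * (2 + Q) + n * (b * (1 + R))))
        ≤ 4 * n ^ 2 * X := by gcongr
      linarith
    have e3 : A₂ * ε ^ 2 * (a₄ / n ^ 2 * R ^ 2 - 8 * (K * R / ε) - 4 * n ^ 2 * X)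
        ≤ A₂ * ε ^ 2 * LW := by gcongr
    have e4 : A₂ * ε ^ 2 * (a₄ / n ^ 2 * R ^ 2 - 8 * (K * R / ε) - 4 * n ^ 2 * X)
        = A₂ * ε ^ 2 * (a₄ / n ^ 2) * R ^ 2 - 8 * A₂ * ε * K * R
          - ε ^ 2 * (4 * A₂ * n ^ 2 * X) := by
      field_simp
    have e5 : ε ^ 2 * (4 * A₂ * n ^ 2 * X) ≤ 4 * A₂ * n ^ 2 * X :=
      mul_le_of_le_one_left (by positivity) (pow_le_one₀ hε0.le hε1.le)
    rw [mul_assoc (4 * A₂ * n ^ 2)]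
    linarith
  linarith

namespace Potentials

lemma admissible_HN' (h : Potentials U G a₁ lam a₂ a₃ s β₂ a₄ a₅ a₆) (hε : 0 < ε)
    (hq : Function.Injective q) : Admissible (HN ε U G) q p :=
  admissible_HN hε h.U_diff h.G_diff hq

lemma admissible_lyapunov (h : Potentials U G a₁ lam a₂ a₃ s β₂ a₄ a₅ a₆) (hε : 0 < ε)
    (hq : Function.Injective q) : Admissible (lyapunov ε s A₁ A₂ κ U G) q p :=
  have hH := h.admissible_HN' (p := p) hε hq
  ((((Admissible.const A₁).mul (hH.pow 3)).add
    ((Admissible.const ε).mul (hH.mul admissible_virial))).add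
    ((Admissible.const (-(A₂ * ε ^ 2))).mul (admissible_corr h.s_pos.le h.s_le_one hq))).add
    (Admissible.const κ)

lemma LN_lyapunov (h : Potentials U G a₁ lam a₂ a₃ s β₂ a₄ a₅ a₆) (hε : 0 < ε)
    (hq : Function.Injective q) :
    LN ε U G (lyapunov ε s A₁ A₂ κ U G) q p
      = A₁ * (3 * HN ε U G q p ^ 2 * LN ε U G (HN ε U G) q p
          + 6 * HN ε U G q p * carre (HN ε U G) (HN ε U G) q p)
        + ε * (HN ε U G q p * LN ε U G virial q p + virial q p * LN ε U G (HN ε U G) q p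
          + 2 * carre (HN ε U G) virial q p)
        + -(A₂ * ε ^ 2) * LN ε U G (corr s) q p := by
  have hH := h.admissible_HN' (p := p) hε hq
  have hS := admissible_virial (q := q) (p := p)
  have hW := admissible_corr (p := p) h.s_pos.le h.s_le_one hq
  have h1 := (Admissible.const A₁).mul (hH.pow 3)
  have h2 := (Admissible.const ε).mul (hH.mul hS)
  have h3 := (Admissible.const (-(A₂ * ε ^ 2))).mul hW
  unfold lyapunov
  rw [LN_add ε U G ((h1.add h2).add h3) (Admissible.const κ), LN_const,
    LN_add ε U G (h1.add h2) h3, LN_add ε U G h1 h2, LN_const_mul ε U G _ (hH.pow 3),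
    LN_const_mul ε U G _ (hH.mul hS), LN_const_mul ε U G _ hW, LN_mul ε U G hH hS,
    LN_pow ε U G hH 2]
  push_cast
  ring

/-- At fixed `ε` all position-dependent quantities are controlled by the Hamiltonian. -/
lemma exists_position_le (h : Potentials U G a₁ lam a₂ a₃ s β₂ a₄ a₅ a₆)
    (hε : ε ∈ Set.Ioo (0 : ℝ) 1) (N : ℕ) :
    ∃ B : ℝ, 0 < B ∧ ∀ q p : Fin N → EuclideanSpace ℝ (Fin d), Function.Injective q →
      1 ≤ HN ε U G q p →
      mom lam q ≤ B * HN ε U G q p ∧ rep s q ≤ B * HN ε U G q p := by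
  obtain ⟨C, hC, hle⟩ := h.exists_le_HN N
  refine ⟨C / ε, div_pos hC hε.1, fun q p hq hH => ?_⟩
  have h1 := hle ε hε q p hq hH
  have hR := rep_nonneg (s := s) (q := q)
  have hQ := mom_nonneg (lam := lam) (q := q)
  rw [div_mul_eq_mul_div, le_div_iff₀ hε.1, le_div_iff₀ hε.1]
  constructor <;> nlinarith [hε.1]

lemma exists_size_le_HN (h : Potentials U G a₁ lam a₂ a₃ s β₂ a₄ a₅ a₆)
    (hε : ε ∈ Set.Ioo (0 : ℝ) 1) (N : ℕ) {δ : ℝ} (hδ : 0 < δ) :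
    ∃ C : ℝ, 0 < C ∧ ∀ q p : Fin N → EuclideanSpace ℝ (Fin d), Function.Injective q →
      1 ≤ HN ε U G q p → size q ≤ δ * HN ε U G q p + C := by
  obtain ⟨B, hB, hle⟩ := h.exists_position_le hε N
  obtain ⟨C, hC, hs⟩ := exists_size_le_mom (d := d) N h.one_le_lam (div_pos hδ hB)
  refine ⟨C, hC, fun q p hq hH => (hs q).trans ?_⟩
  have h1 := (hle q p hq hH).1
  have h2 : δ / B * mom lam q ≤ δ / B * (B * HN ε U G q p) := by gcongr
  have h3 : δ / B * (B * HN ε U G q p) = δ * HN ε U G q p := by field_simp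
  linarith

/-- The error weight `(1 + |q|) H` is negligible against `H²`. -/
lemma exists_weight_le_sq (h : Potentials U G a₁ lam a₂ a₃ s β₂ a₄ a₅ a₆)
    (hε : ε ∈ Set.Ioo (0 : ℝ) 1) (N : ℕ) {δ : ℝ} (hδ : 0 < δ) :
    ∃ C : ℝ, 0 < C ∧ ∀ q p : Fin N → EuclideanSpace ℝ (Fin d), Function.Injective q →
      1 ≤ HN ε U G q p → (1 + size q) * HN ε U G q p ≤ δ * HN ε U G q p ^ 2 + C := by
  obtain ⟨C, hC, hs⟩ := h.exists_size_le_HN hε N (half_pos hδ)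
  refine ⟨(1 + C) ^ 2 / (2 * δ), by positivity, fun q p hq hH => ?_⟩
  have h1 := hs q p hq hH
  set H := HN ε U G q p
  have h2 : (1 + size q) * H ≤ (1 + (δ / 2 * H + C)) * H := by gcongr
  have h3 : (1 + C) * H ≤ δ / 2 * H ^ 2 + (1 + C) ^ 2 / (2 * δ) := by
    have e : δ / 2 * H ^ 2 + (1 + C) ^ 2 / (2 * δ) - (1 + C) * H
        = (δ * H - (1 + C)) ^ 2 / (2 * δ) := by
      field_simp
      ring
    have : 0 ≤ (δ * H - (1 + C)) ^ 2 / (2 * δ) := by positivity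
    linarith
  nlinarith

lemma exists_LN_lyapunov_le (h : Potentials U G a₁ lam a₂ a₃ s β₂ a₄ a₅ a₆)
    (hε : ε ∈ Set.Ioo (0 : ℝ) 1) (hN : 2 ≤ N) (hA₁ : 0 < A₁) (hA₂ : 0 < A₂) :
    ∃ C : ℝ, 0 < C ∧ ∀ (κ : ℝ) (q p : Fin N → EuclideanSpace ℝ (Fin d)), Function.Injective q →
      1 ≤ pot U G q →
      LN ε U G (lyapunov ε s A₁ A₂ κ U G) q p
        ≤ 3 * A₁ * HN ε U G q p ^ 2 * LN ε U G (HN ε U G) q p + HN ε U G q p * kinSum ε p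
          - ε * a₂ * HN ε U G q p * mom lam q + ε * a₁ * HN ε U G q p * rep s q
          + 8 * A₂ * ε * kinSum ε p * rep s q - A₂ * ε ^ 2 * (a₄ / N ^ 2) * rep s q ^ 2
          + C * ((1 + size q) * HN ε U G q p) := by
  obtain ⟨B, hB, hle⟩ := h.exists_position_le hε N
  have ha₁ := h.a₁_pos
  have ha₃ := h.a₃_pos
  have ha₆ := h.a₆_pos
  have hε0 := hε.1
  refine ⟨6 * A₁ * (N * d) + 1 + N * a₃ + 2 * a₁ * N ^ 2 + (N + N * d) + 2 * (N * d)
    + 4 * A₂ * N ^ 2 * (1 / ε + a₁ * (2 + B) + N * ((|a₅| + a₆) * (1 + B))), by positivity,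
    fun κ q p hq hpot => ?_⟩
  have hKH := kinSum_le_HN (p := p) hε.1 hpot
  have hK := one_le_kinSum (p := p) hε.1 hN
  have hH : 1 ≤ HN ε U G q p := hK.trans hKH
  rw [h.LN_lyapunov hε.1 hq]
  have hn : (1 : ℝ) ≤ N := by exact_mod_cast (by omega : 1 ≤ N)
  refine drift_le_of_bounds (P := ∑ x ∈ pairs N, (‖q x.1 - q x.2‖ ^ (-s)) ^ 2)
    (b := |a₅| + a₆) (n := N) (m := N * d) hε hA₁ hA₂ ha₁ ha₃ h.a₄_pos (by positivity) hB hn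
    (by positivity) hH kinSum_nonneg hKH size_nonneg (hle q p hq hH).1 (hle q p hq hH).2
    ?_ ?_ (abs_virial_le hε) (h.abs_LN_HN_le hε hq) (h.LN_virial_le hε hq)
    (h.le_LN_corr hε hq) (rep_sq_le s q)
  · simpa using abs_carre_le (abs_fderiv_HN_dir_le (U := U) (G := G) (q := q) (p := p) hε)
      (abs_fderiv_HN_dir_le (U := U) (G := G) (q := q) (p := p) hε)
  · simpa using abs_carre_le (abs_fderiv_HN_dir_le (U := U) (G := G) (q := q) (p := p) hε)
      (abs_fderiv_virial_dir_le (q := q) (p := p))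

end Potentials

end Lyapunov

section Dissipation

variable {d N : ℕ} {ε lam s A₁ A₂ κ : ℝ} {q p : Fin N → EuclideanSpace ℝ (Fin d)}
  {U G : EuclideanSpace ℝ (Fin d) → ℝ} {a₁ a₂ a₃ β₂ a₄ a₅ a₆ : ℝ}

lemma quadratic_le_of_large {H K LH Q R A₁ A₂ A ε a₁ a₂ B T : ℝ} (hε : 0 < ε) (hA₂ : 0 < A₂)
    (hA : 0 ≤ A) (ha₁ : 0 < a₁) (ha₂ : 0 < a₂) (hA₁0 : 0 < A₁)
    (hA₁ : 3 / 4 * A₁ = 2 + a₁ * B + 8 * A₂ * B)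
    (hH : 1 ≤ H) (hKH : K ≤ H) (hQ : 0 ≤ Q)
    (hR : ε * R ≤ B * H) (hR0 : 0 ≤ R) (hLH : LH ≤ -(1 / 4)) :
    3 * A₁ * H ^ 2 * LH + H * K - ε * a₂ * H * Q + ε * a₁ * H * R + 8 * A₂ * ε * K * R
      - A₂ * ε ^ 2 * A * R ^ 2 + T ≤ -H ^ 2 + T := by
  have h1 : 3 * A₁ * H ^ 2 * LH ≤ 3 * A₁ * H ^ 2 * -(1 / 4) := by gcongr
  have h2 : H * K ≤ H * H := by gcongr
  have h3 : 0 ≤ ε * a₂ * H * Q := by positivity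
  have h4 : a₁ * H * (ε * R) ≤ a₁ * H * (B * H) := by gcongr
  have h5 : 8 * A₂ * K * (ε * R) ≤ 8 * A₂ * H * (B * H) := by gcongr
  have h6 : 0 ≤ A₂ * ε ^ 2 * A * R ^ 2 := by positivity
  have h7 : 3 * A₁ * H ^ 2 * -(1 / 4) = -(3 / 4 * A₁) * H ^ 2 := by ring
  rw [h7, hA₁] at h1
  linarith

lemma quadratic_le_of_small {H K LH Q R A₁ A₂ A ε a₁ a₂ B D M T m : ℝ} (hε : 0 < ε)
    (hA₂ : 0 < A₂) (ha₂ : 0 < a₂) (hA₁ : 0 < A₁) (hD : 0 < D)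
    (hA : A₂ * A = D * (a₁ + a₂) ^ 2 / (2 * a₂))
    (hm : 3 * A₁ * m ≤ a₂ / (4 * D)) (hM : 0 ≤ M)
    (hH : 1 ≤ H) (hK : K ≤ M) (hR0 : 0 ≤ R)
    (hR : ε * R ≤ B * H) (hLH : LH ≤ m) (hle : H ≤ D * (ε * (Q + R)) + D + K) :
    3 * A₁ * H ^ 2 * LH + H * K - ε * a₂ * H * Q + ε * a₁ * H * R + 8 * A₂ * ε * K * R
      - A₂ * ε ^ 2 * A * R ^ 2 + T
      ≤ -(a₂ / (4 * D)) * H ^ 2 + T + (M + 8 * A₂ * M * B + a₂ / D * (D + M)) * H := by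
  have h1 : 3 * A₁ * H ^ 2 * LH ≤ a₂ / (4 * D) * H ^ 2 := by
    calc 3 * A₁ * H ^ 2 * LH ≤ 3 * A₁ * H ^ 2 * m := by gcongr
      _ = 3 * A₁ * m * H ^ 2 := by ring
      _ ≤ _ := by gcongr
  have h2 : H * K ≤ M * H := by nlinarith
  have h5 : 8 * A₂ * K * (ε * R) ≤ 8 * A₂ * M * (B * H) := by gcongr
  have h3 : a₂ / D * H * H ≤ a₂ / D * H * (D * (ε * (Q + R)) + D + M) := by
    gcongr
    linarith
  have h4 : a₂ / D * H * (D * (ε * (Q + R)) + D + M)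
      = ε * a₂ * H * Q + ε * a₂ * H * R + a₂ / D * (D + M) * H := by
    field_simp
    ring
  have h6 : A₂ * ε ^ 2 * A * R ^ 2 - (a₁ + a₂) * H * (ε * R) + a₂ / (2 * D) * H ^ 2
      = (D * (a₁ + a₂) * (ε * R) - a₂ * H) ^ 2 / (2 * D * a₂) := by
    have : A₂ * ε ^ 2 * A * R ^ 2 = A₂ * A * (ε * R) ^ 2 := by ring
    rw [this, hA]
    field_simp
    ring
  have h7 : 0 ≤ (D * (a₁ + a₂) * (ε * R) - a₂ * H) ^ 2 / (2 * D * a₂) := by positivity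
  have h8 : a₂ / D = 4 * (a₂ / (4 * D)) := by field_simp
  have h9 : a₂ / (2 * D) = 2 * (a₂ / (4 * D)) := by field_simp; norm_num
  rw [h4, h8] at h3
  rw [h9] at h6
  rw [h8]
  nlinarith

/-- The diffusive and dissipative estimates combine to quadratic decay in the Hamiltonian. -/
lemma Potentials.exists_LN_lyapunov_le_neg_sq
    (h : Potentials U G a₁ lam a₂ a₃ s β₂ a₄ a₅ a₆) (hN : 2 ≤ N) :
    ∃ ε₀ ∈ Set.Ioo (0 : ℝ) 1, ∃ A₁ A₂ : ℝ, 0 < A₁ ∧ 0 < A₂ ∧ ∀ ε ∈ Set.Ioo (0 : ℝ) ε₀,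
      ∃ c C : ℝ, 0 < c ∧ 0 < C ∧ ∀ (κ : ℝ) (q p : Fin N → EuclideanSpace ℝ (Fin d)),
        Function.Injective q → 1 ≤ pot U G q →
        LN ε U G (lyapunov ε s A₁ A₂ κ U G) q p ≤ -c * HN ε U G q p ^ 2 + C := by
  obtain ⟨D, hD, hDle⟩ := h.exists_HN_le N
  obtain ⟨B, hB, hBle⟩ := h.exists_le_HN N
  have ha₁ := h.a₁_pos
  have ha₂ := h.a₂_pos
  have ha₄ := h.a₄_pos
  have hn : (0 : ℝ) < N := by exact_mod_cast (by omega : 0 < N)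
  obtain ⟨A₂, hA₂⟩ : ∃ A₂ : ℝ, A₂ = N ^ 2 * D * (a₁ + a₂) ^ 2 / (2 * a₂ * a₄) := ⟨_, rfl⟩
  have hA₂0 : 0 < A₂ := by rw [hA₂]; positivity
  have hA₂' : A₂ * (a₄ / N ^ 2) = D * (a₁ + a₂) ^ 2 / (2 * a₂) := by
    rw [hA₂]
    field_simp
  obtain ⟨A₁, hA₁⟩ : ∃ A₁ : ℝ, A₁ = 4 / 3 * (2 + a₁ * B + 8 * A₂ * B) := ⟨_, rfl⟩
  have hA₁0 : 0 < A₁ := by rw [hA₁]; positivity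
  have hA₁' : 3 / 4 * A₁ = 2 + a₁ * B + 8 * A₂ * B := by rw [hA₁]; ring
  obtain ⟨η, hη⟩ : ∃ η : ℝ, η = a₂ / (4 * D) := ⟨_, rfl⟩
  have hη0 : 0 < η := by rw [hη]; positivity
  obtain ⟨m, hm⟩ : ∃ m : ℝ, m = N * d := ⟨_, rfl⟩
  have hm0 : 0 ≤ m := by rw [hm]; positivity
  obtain ⟨b, hb, hb1, hb2, hb3⟩ : ∃ b : ℝ, 0 < b ∧ b < 1 ∧ b * m ≤ 1 / 4 ∧ 3 * A₁ * (b * m) ≤ η := by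
    refine ⟨min (1 / 2) (min (1 / (4 * (m + 1))) (η / (3 * A₁ * (m + 1)))), by positivity,
      (min_le_left _ _).trans_lt (by norm_num), ?_, ?_⟩
    · have e := (min_le_right (1 / 2) (min (1 / (4 * (m + 1))) (η / (3 * A₁ * (m + 1))))).trans
        (min_le_left _ _)
      refine (mul_le_mul_of_nonneg_right e hm0).trans ?_
      rw [div_mul_eq_mul_div, div_le_div_iff₀ (by positivity) (by norm_num)]
      linarith
    · have e := (min_le_right (1 / 2) (min (1 / (4 * (m + 1))) (η / (3 * A₁ * (m + 1))))).trans
        (min_le_right _ _)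
      refine (mul_le_mul_of_nonneg_left (mul_le_mul_of_nonneg_right e hm0)
        (by positivity)).trans ?_
      rw [div_mul_eq_mul_div, mul_div_assoc', div_le_iff₀ (by positivity)]
      nlinarith [mul_pos hη0 hA₁0]
  refine ⟨b, ⟨hb, hb1⟩, A₁, A₂, hA₁0, hA₂0, fun ε hε => ?_⟩
  have hε1 : ε ∈ Set.Ioo (0 : ℝ) 1 := ⟨hε.1, hε.2.trans hb1⟩
  have hεm : ε * m ≤ b * m := mul_le_mul_of_nonneg_right hε.2.le hm0
  obtain ⟨C, hC, hle⟩ := h.exists_LN_lyapunov_le hε1 hN hA₁0 hA₂0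
  set M : ℝ := 2 * N with hM
  set C' : ℝ := C + (M + 8 * A₂ * M * B + a₂ / D * (D + M)) with hC'
  have hX : 0 < M + 8 * A₂ * M * B + a₂ / D * (D + M) := by positivity
  obtain ⟨c, hc⟩ : ∃ c : ℝ, c = min 1 η := ⟨_, rfl⟩
  have hc0 : 0 < c := by rw [hc]; positivity
  have hC'0 : 0 < C' := by positivity
  obtain ⟨E, hE, hEle⟩ := h.exists_weight_le_sq hε1 N (δ := c / (2 * C')) (by positivity)
  refine ⟨c / 2, C' * E, by positivity, by positivity, fun κ q p hq hpot => ?_⟩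
  have hKH := kinSum_le_HN (p := p) hε.1 hpot
  have hK := one_le_kinSum (p := p) hε.1 hN
  have hH : 1 ≤ HN ε U G q p := hK.trans hKH
  have hR0 := rep_nonneg (s := s) (q := q)
  have hQ0 := mom_nonneg (lam := lam) (q := q)
  have hS0 := size_nonneg (q := q)
  have hR : ε * rep s q ≤ B * HN ε U G q p := by
    have := hBle ε hε1 q p hq hH
    nlinarith [mul_nonneg hε.1.le hQ0]
  have key : LN ε U G (lyapunov ε s A₁ A₂ κ U G) q p
      ≤ -c * HN ε U G q p ^ 2 + C' * ((1 + size q) * HN ε U G q p) := by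
    refine (hle κ q p hq hpot).trans ?_
    have hT : HN ε U G q p ≤ (1 + size q) * HN ε U G q p := by nlinarith
    by_cases hlarge : ∃ i, 1 ≤ ε * ‖p i‖ ^ 2
    · obtain ⟨i, hi⟩ := hlarge
      have hLH := h.LN_HN_le_of_large hε.1 hq hi
      rw [← hm] at hLH
      refine (quadratic_le_of_large hε.1 hA₂0 (by positivity) ha₁ ha₂ hA₁0 hA₁' hH
        hKH hQ0 hR hR0 (by linarith)).trans ?_
      have e1 : c * HN ε U G q p ^ 2 ≤ 1 * HN ε U G q p ^ 2 := by
        gcongr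
        rw [hc]
        exact min_le_left _ _
      have e2 : C * ((1 + size q) * HN ε U G q p) ≤ C' * ((1 + size q) * HN ε U G q p) := by
        gcongr
        linarith
      linarith
    · push Not at hlarge
      have hLH := h.LN_HN_le (p := p) hε.1 hq
      rw [← hm] at hLH
      refine (quadratic_le_of_small (M := M) hε.1 hA₂0 ha₂ hA₁0 hD hA₂'
        ((mul_le_mul_of_nonneg_left hεm (by positivity)).trans (hb3.trans hη.le)) (by positivity)
        hH (kinSum_le_of_small hε.1 fun i => (hlarge i).le) hR0 hR hLH
        (hDle ε hε1 q p hq)).trans ?_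
      rw [← hη]
      have e1 : c * HN ε U G q p ^ 2 ≤ η * HN ε U G q p ^ 2 := by
        gcongr
        rw [hc]
        exact min_le_right _ _
      have e2 := mul_le_mul_of_nonneg_left hT hX.le
      rw [hC', add_mul]
      linarith
  have e := mul_le_mul_of_nonneg_left (hEle q p hq hH) hC'0.le
  have e' : C' * (c / (2 * C') * HN ε U G q p ^ 2 + E) = c / 2 * HN ε U G q p ^ 2 + C' * E := by
    field_simp
  linarith

end Dissipation

section Comparison

variable {d N : ℕ} {ε lam s A₁ A₂ κ : ℝ} {q p : Fin N → EuclideanSpace ℝ (Fin d)}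
  {U G : EuclideanSpace ℝ (Fin d) → ℝ} {a₁ a₂ a₃ β₂ a₄ a₅ a₆ : ℝ}

lemma abs_perturbation_le (hε : ε ∈ Set.Ioo (0 : ℝ) 1) (hs0 : 0 ≤ s) (hs1 : s ≤ 1)
    (hA₂ : 0 < A₂) (hN : 2 ≤ N) (hpot : 1 ≤ pot U G q) :
    |ε * (HN ε U G q p * virial q p) + (-(A₂ * ε ^ 2)) * corr s q p|
      ≤ (1 + 4 * A₂ * N ^ 2) * ((1 + size q) * HN ε U G q p ^ 2) := by
  have hKH := kinSum_le_HN (p := p) hε.1 hpot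
  have hK := one_le_kinSum (p := p) hε.1 hN
  have hS := abs_virial_le (q := q) (p := p) hε
  have hW := abs_corr_le (q := q) (p := p) hε hs0 hs1
  have hS0 := size_nonneg (q := q)
  obtain ⟨hε0, hε1⟩ := hε
  set H := HN ε U G q p
  set K := kinSum ε p
  have hH : 1 ≤ H := hK.trans hKH
  have h1 : |ε * (H * virial q p)| ≤ (1 + size q) * H ^ 2 := by
    rw [abs_mul, abs_mul, abs_of_pos hε0, abs_of_pos (one_pos.trans_le hH)]
    calc ε * (H * |virial q p|) ≤ ε * (H * (size q * (K / ε))) := by gcongr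
      _ = size q * H * K := by field_simp
      _ ≤ (1 + size q) * H * H := by gcongr; linarith
      _ = _ := by ring
  have h2 : |(-(A₂ * ε ^ 2)) * corr s q p| ≤ 4 * A₂ * N ^ 2 * ((1 + size q) * H ^ 2) := by
    rw [abs_mul, abs_neg, abs_of_pos (by positivity)]
    calc A₂ * ε ^ 2 * |corr s q p|
        ≤ A₂ * ε ^ 2 * (4 * N ^ 2 * ((1 + size q) * (K / ε))) := by gcongr
      _ = ε * (4 * A₂ * N ^ 2 * ((1 + size q) * K)) := by field_simp
      _ ≤ 4 * A₂ * N ^ 2 * ((1 + size q) * K) :=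
        mul_le_of_le_one_left (by positivity) hε1.le
      _ ≤ 4 * A₂ * N ^ 2 * ((1 + size q) * H ^ 2) := by
        gcongr
        nlinarith
  refine (abs_add_le _ _).trans ?_
  linarith

/-- The Lyapunov candidate is comparable with the cube of the Hamiltonian. -/
lemma Potentials.exists_lyapunov_bounds (h : Potentials U G a₁ lam a₂ a₃ s β₂ a₄ a₅ a₆)
    (hε : ε ∈ Set.Ioo (0 : ℝ) 1) (hN : 2 ≤ N) (hA₁ : 0 < A₁) (hA₂ : 0 < A₂) :
    ∃ κ C : ℝ, 0 < κ ∧ 0 < C ∧ ∀ q p : Fin N → EuclideanSpace ℝ (Fin d), Function.Injective q →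
      1 ≤ pot U G q → 1 ≤ lyapunov ε s A₁ A₂ κ U G q p ∧
      A₁ / 2 * HN ε U G q p ^ 3 ≤ lyapunov ε s A₁ A₂ κ U G q p ∧
      lyapunov ε s A₁ A₂ κ U G q p ≤ C * HN ε U G q p ^ 3 := by
  set D : ℝ := 1 + 4 * A₂ * N ^ 2 with hD
  have hD0 : 0 < D := by positivity
  obtain ⟨E, hE, hEle⟩ := h.exists_weight_le_sq hε N (δ := A₁ / (4 * D)) (by positivity)
  set F : ℝ := (D * E) ^ 2 / A₁ with hF
  have hF0 : 0 < F := by positivity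
  refine ⟨F + 1, 2 * A₁ + 2 * F + 1, by positivity, by positivity, fun q p hq hpot => ?_⟩
  have hH : 1 ≤ HN ε U G q p :=
    (one_le_kinSum (p := p) hε.1 hN).trans (kinSum_le_HN (p := p) hε.1 hpot)
  have h1 := abs_perturbation_le (p := p) hε h.s_pos.le h.s_le_one hA₂ hN hpot
  have h2 := hEle q p hq hH
  unfold lyapunov
  set H := HN ε U G q p
  have hH2 : H ^ 2 ≤ H ^ 3 := pow_le_pow_right₀ hH (by norm_num)
  have hH3 : 1 ≤ H ^ 3 := one_le_pow₀ hH
  have h3 : D * ((1 + size q) * H ^ 2) ≤ A₁ / 2 * H ^ 3 + F := by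
    have e1 : D * ((1 + size q) * H ^ 2) ≤ D * H * (A₁ / (4 * D) * H ^ 2 + E) := by
      calc D * ((1 + size q) * H ^ 2) = D * H * ((1 + size q) * H) := by ring
        _ ≤ _ := by gcongr
    have e2 : D * H * (A₁ / (4 * D) * H ^ 2 + E) = A₁ / 4 * H ^ 3 + D * E * H := by
      field_simp
    have e3 : A₁ / 4 * H ^ 2 + F - D * E * H = (A₁ * H - 2 * (D * E)) ^ 2 / (4 * A₁) := by
      rw [hF]
      field_simp
      ring
    have e4 : 0 ≤ (A₁ * H - 2 * (D * E)) ^ 2 / (4 * A₁) := by positivity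
    have e5 : A₁ / 4 * H ^ 2 ≤ A₁ / 4 * H ^ 3 := by gcongr
    linarith
  obtain ⟨h4, h5⟩ := abs_le.mp h1
  have h6 : 0 ≤ A₁ / 2 * H ^ 3 := by positivity
  have h7 : F * 1 ≤ F * H ^ 3 := by gcongr
  refine ⟨by linarith, by linarith, by linarith⟩

lemma Potentials.exists_carre_lyapunov_le (h : Potentials U G a₁ lam a₂ a₃ s β₂ a₄ a₅ a₆)
    (hε : ε ∈ Set.Ioo (0 : ℝ) 1) (hN : 2 ≤ N) (hA₁ : 0 < A₁) (hA₂ : 0 < A₂) :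
    ∃ C : ℝ, 0 < C ∧ ∀ (κ : ℝ) (q p : Fin N → EuclideanSpace ℝ (Fin d)), Function.Injective q →
      1 ≤ pot U G q → carre (lyapunov ε s A₁ A₂ κ U G) (lyapunov ε s A₁ A₂ κ U G) q p
        ≤ C * HN ε U G q p ^ 4 := by
  obtain ⟨B, hB, hBle⟩ := h.exists_size_le_HN hε N one_pos
  have hε0 := hε.1
  set C : ℝ := 3 * A₁ + 2 * (1 + B) + 4 * A₂ * N ^ 2 * (2 + B) with hC
  refine ⟨N * d * C ^ 2 + 1, by positivity, fun κ q p hq hpot => ?_⟩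
  have hKH := kinSum_le_HN (p := p) hε.1 hpot
  have hK := one_le_kinSum (p := p) hε.1 hN
  have hH : 1 ≤ HN ε U G q p := hK.trans hKH
  have hS0 := size_nonneg (q := q)
  have hS : size q ≤ (1 + B) * HN ε U G q p := by
    have := hBle q p hq hH
    nlinarith
  have hb : ∀ i α, |fderiv ℝ (lyapunov ε s A₁ A₂ κ U G q) p (dir i α)|
      ≤ C * HN ε U G q p ^ 2 := by
    intro i α
    have dH := ((contDiff_HN (U := U) (G := G) (q := q) hε.1).differentiable
      two_ne_zero p).hasFDerivAt
    have dS := ((contDiff_virial (q := q)).differentiable two_ne_zero p).hasFDerivAt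
    have dW := ((admissible_corr (p := p) h.s_pos.le h.s_le_one hq).2.differentiable
      two_ne_zero p).hasFDerivAt
    have dV := ((((dH.pow 3).const_mul A₁).fun_add ((dH.fun_mul dS).const_mul ε)).fun_add
      (dW.const_mul (-(A₂ * ε ^ 2)))).add_const κ
    have e : fderiv ℝ (lyapunov ε s A₁ A₂ κ U G q) p = _ := dV.fderiv
    rw [e]
    have b1 := abs_fderiv_HN_dir_le (U := U) (G := G) (q := q) (p := p) hε i α
    have b2 := abs_fderiv_virial_dir_le (q := q) (p := p) i α
    have b3 := abs_fderiv_corr_dir_le (q := q) (p := p) h.s_pos.le h.s_le_one i α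
    have b4 := abs_virial_le (q := q) (p := p) hε
    simp only [add_apply, smul_apply, smul_eq_mul, nsmul_eq_mul]
    set H := HN ε U G q p
    set x := fderiv ℝ (HN ε U G q) p (dir i α)
    set y := fderiv ℝ (virial q) p (dir i α)
    set z := fderiv ℝ (corr s q) p (dir i α)
    have t1 : |A₁ * (3 * H ^ 2 * x)| ≤ 3 * A₁ * H ^ 2 := by
      rw [abs_mul, abs_mul, abs_of_pos hA₁, abs_of_pos (by positivity)]
      calc A₁ * (3 * H ^ 2 * |x|) ≤ A₁ * (3 * H ^ 2 * 1) := by gcongr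
        _ = _ := by ring
    have t2 : |ε * (H * y)| ≤ (1 + B) * H ^ 2 := by
      rw [abs_mul, abs_mul, abs_of_pos hε0, abs_of_pos (one_pos.trans_le hH)]
      calc ε * (H * |y|) ≤ 1 * (H * ((1 + B) * H)) := by
            gcongr
            · exact hε.2.le
            · exact b2.trans hS
        _ = _ := by ring
    have t3 : |ε * (virial q p * x)| ≤ (1 + B) * H ^ 2 := by
      rw [abs_mul, abs_mul, abs_of_pos hε0]
      calc ε * (|virial q p| * |x|) ≤ ε * (size q * (kinSum ε p / ε) * 1) := by gcongr
        _ = size q * kinSum ε p := by field_simp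
        _ ≤ (1 + B) * H * H := by gcongr
        _ = _ := by ring
    have t4 : |(-(A₂ * ε ^ 2)) * z| ≤ 4 * A₂ * N ^ 2 * (2 + B) * H ^ 2 := by
      rw [abs_mul, abs_neg, abs_of_pos (by positivity)]
      have e1 : 1 + size q ≤ (2 + B) * H ^ 2 := by nlinarith
      calc A₂ * ε ^ 2 * |z| ≤ A₂ * 1 * (4 * N ^ 2 * ((2 + B) * H ^ 2)) := by
            gcongr
            · exact pow_le_one₀ hε0.le hε.2.le
            · exact b3.trans (by gcongr)
        _ = _ := by ring
    have s1 := abs_le.mp t1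
    have s2 := abs_le.mp t2
    have s3 := abs_le.mp t3
    have s4 := abs_le.mp t4
    rw [hC, abs_le]
    simp only [Nat.reduceSub, Nat.cast_ofNat]
    constructor <;> linarith
  refine (le_abs_self _).trans ((abs_carre_le hb hb).trans ?_)
  have : 0 ≤ HN ε U G q p ^ 4 := by positivity
  linarith

end Comparison

section Powers

variable {d N : ℕ} {ε lam s : ℝ}
  {U G : EuclideanSpace ℝ (Fin d) → ℝ} {a₁ a₂ a₃ β₂ a₄ a₅ a₆ : ℝ}

lemma mul_pow_le_mul_pow_succ_add {c D x : ℝ} (hc : 0 < c) (hD : 0 ≤ D) (hx : 0 ≤ x) (k : ℕ) :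
    D * x ^ k ≤ c * x ^ (k + 1) + D * (D / c) ^ k := by
  rcases le_total x (D / c) with hxc | hxc
  · have h1 : D * x ^ k ≤ D * (D / c) ^ k := by gcongr
    have h2 : 0 ≤ c * x ^ (k + 1) := by positivity
    linarith
  · have h1 : D * x ^ k ≤ c * x ^ (k + 1) := by
      rw [div_le_iff₀ hc] at hxc
      have h3 : 0 ≤ x ^ k := by positivity
      rw [pow_succ]
      nlinarith
    have h2 : 0 ≤ D * (D / c) ^ k := by positivity
    linarith

lemma exists_cube_root_bound {b : ℝ} (hb : 0 < b) :
    ∃ M : ℝ, 0 < M ∧ ∀ x y : ℝ, 0 ≤ y → x ^ 3 ≤ b * y ^ 3 → x ≤ M * y := by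
  refine ⟨b + 1, by positivity, fun x y hy hxy => ?_⟩
  refine le_of_pow_le_pow_left₀ three_ne_zero (by positivity) (hxy.trans ?_)
  rw [mul_pow]
  have h1 : b ≤ (b + 1) ^ 3 := by nlinarith [pow_pos hb 3, sq_nonneg b]
  gcongr

lemma power_drift_le {v H L Γ c C D M M' : ℝ} (hv : 1 ≤ v) (hc : 0 < c) (hC : 0 < C)
    (hD : 0 < D) (hM : 0 < M) (hM' : 0 < M') (hH : 1 ≤ H)
    (hvH : v ≤ M * H) (hHv : H ≤ M' * v) (hL : L ≤ -c * H ^ 2 + C) (hΓ : Γ ≤ D * H ^ 4)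
    (m : ℕ) :
    (m + 1) * (v ^ 3) ^ m * L + (m + 1) * m * (v ^ 3) ^ (m - 1) * Γ
      ≤ -((m + 1) * (c / (2 * M ^ 2))) * v ^ (3 * m + 2)
        + (m + 1) * ((C + m * (D * M' ^ 4))
          * ((C + m * (D * M' ^ 4)) / (c / (2 * M ^ 2))) ^ (3 * m + 1)) := by
  have hv0 : 0 < v := by linarith
  have hc' : 0 < c / (2 * M ^ 2) := by positivity
  have h1 : (v ^ 3) ^ m * L ≤ -(2 * (c / (2 * M ^ 2))) * v ^ (3 * m + 2) + C * v ^ (3 * m + 1) := by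
    have e1 : v ^ 2 ≤ M ^ 2 * H ^ 2 := by rw [← mul_pow]; gcongr
    have e2 : c / M ^ 2 * v ^ 2 ≤ c * H ^ 2 := by
      rw [div_mul_eq_mul_div, div_le_iff₀ (by positivity)]
      nlinarith
    have e3 : C ≤ C * v := le_mul_of_one_le_right hC.le hv
    have e4 : L ≤ -(c / M ^ 2) * v ^ 2 + C * v := by linarith
    calc (v ^ 3) ^ m * L ≤ (v ^ 3) ^ m * (-(c / M ^ 2) * v ^ 2 + C * v) := by gcongr
      _ = _ := by
        field_simp
        ring
  have h2 : m * (v ^ 3) ^ (m - 1) * Γ ≤ m * (D * M' ^ 4) * v ^ (3 * m + 1) := by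
    rcases m with _ | k
    · simp
    · have e1 : Γ ≤ D * (M' * v) ^ 4 := hΓ.trans (by gcongr)
      calc ((k + 1 : ℕ) : ℝ) * (v ^ 3) ^ (k + 1 - 1) * Γ
          ≤ ((k + 1 : ℕ) : ℝ) * (v ^ 3) ^ (k + 1 - 1) * (D * (M' * v) ^ 4) := by gcongr
        _ = _ := by
          rw [Nat.add_sub_cancel]
          ring
  have h3 := mul_pow_le_mul_pow_succ_add hc' (D := C + m * (D * M' ^ 4)) (by positivity) hv0.le
    (3 * m + 1)
  have h4 : (v ^ 3) ^ m * L + m * (v ^ 3) ^ (m - 1) * Γ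
      ≤ -(c / (2 * M ^ 2)) * v ^ (3 * m + 2) + (C + m * (D * M' ^ 4))
          * ((C + m * (D * M' ^ 4)) / (c / (2 * M ^ 2))) ^ (3 * m + 1) := by
    rw [show 3 * m + 1 + 1 = 3 * m + 2 from rfl] at h3
    linarith
  have h5 := mul_le_mul_of_nonneg_left h4 (by positivity : (0 : ℝ) ≤ m + 1)
  linarith

/-- The Lyapunov candidate is at least `1` and all its powers satisfy a drift condition. -/
theorem Potentials.exists_lyapunov_drift (h : Potentials U G a₁ lam a₂ a₃ s β₂ a₄ a₅ a₆)
    (hN : 2 ≤ N)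
    (hpot : ∀ q : Fin N → EuclideanSpace ℝ (Fin d), Function.Injective q → 1 ≤ pot U G q) :
    ∃ ε₀ ∈ Set.Ioo (0 : ℝ) 1, ∀ ε ∈ Set.Ioo (0 : ℝ) ε₀,
      ∃ A₁ A₂ κ : ℝ, 0 < A₁ ∧ 0 < A₂ ∧ 0 < κ ∧
        (∀ q : Fin N → EuclideanSpace ℝ (Fin d), Function.Injective q →
          ∀ p : Fin N → EuclideanSpace ℝ (Fin d), 1 ≤ lyapunov ε s A₁ A₂ κ U G q p) ∧
        ∀ n : ℕ, 1 ≤ n → ∃ c C : ℝ, 0 < c ∧ 0 < C ∧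
          ∀ q : Fin N → EuclideanSpace ℝ (Fin d), Function.Injective q →
            ∀ p : Fin N → EuclideanSpace ℝ (Fin d),
              LN ε U G (fun q p => lyapunov ε s A₁ A₂ κ U G q p ^ n) q p
                ≤ -c * lyapunov ε s A₁ A₂ κ U G q p ^ ((n : ℝ) - 1 / 3) + C := by
  obtain ⟨ε₀, hε₀, A₁, A₂, hA₁, hA₂, hdrift⟩ := h.exists_LN_lyapunov_le_neg_sq hN
  refine ⟨ε₀, hε₀, fun ε hε => ?_⟩
  have hε1 : ε ∈ Set.Ioo (0 : ℝ) 1 := ⟨hε.1, hε.2.trans hε₀.2⟩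
  obtain ⟨c, C, hc, hC, hL⟩ := hdrift ε hε
  obtain ⟨κ, B, hκ, hB, hV⟩ := h.exists_lyapunov_bounds hε1 hN hA₁ hA₂
  obtain ⟨D, hD, hΓ⟩ := h.exists_carre_lyapunov_le hε1 hN hA₁ hA₂
  obtain ⟨M, hM, hMle⟩ := exists_cube_root_bound hB
  obtain ⟨M', hM', hMle'⟩ := exists_cube_root_bound (b := 2 / A₁) (by positivity)
  refine ⟨A₁, A₂, κ, hA₁, hA₂, hκ, fun q hq p => (hV q p hq (hpot q hq)).1, fun n hn => ?_⟩
  obtain ⟨m, rfl⟩ : ∃ m, n = m + 1 := ⟨n - 1, by omega⟩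
  refine ⟨(m + 1) * (c / (2 * M ^ 2)), (m + 1) * ((C + m * (D * M' ^ 4))
    * ((C + m * (D * M' ^ 4)) / (c / (2 * M ^ 2))) ^ (3 * m + 1)), by positivity, by positivity,
    fun q hq p => ?_⟩
  obtain ⟨hV1, hV2, hV3⟩ := hV q p hq (hpot q hq)
  have hH : 1 ≤ HN ε U G q p :=
    (one_le_kinSum (p := p) hε.1 hN).trans (kinSum_le_HN (p := p) hε.1 (hpot q hq))
  rw [LN_pow ε U G (h.admissible_lyapunov hε.1 hq) m]
  have hL' := hL κ q p hq (hpot q hq)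
  have hΓ' := hΓ κ q p hq (hpot q hq)
  set V := lyapunov ε s A₁ A₂ κ U G q p
  set v := V ^ (1 / 3 : ℝ) with hvdef
  have hV0 : 0 ≤ V := by linarith
  have hv : 1 ≤ v := Real.one_le_rpow hV1 (by norm_num)
  have hv3 : v ^ 3 = V := by
    rw [hvdef, ← Real.rpow_natCast, ← Real.rpow_mul hV0]
    norm_num
  have hvn : V ^ (((m + 1 : ℕ) : ℝ) - 1 / 3) = v ^ (3 * m + 2) := by
    rw [hvdef, ← Real.rpow_natCast, ← Real.rpow_mul hV0]
    congr 1
    push_cast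
    ring
  rw [hvn]
  have hHv : HN ε U G q p ≤ M' * v := by
    refine hMle' _ _ (by linarith) ?_
    rw [hv3, div_mul_eq_mul_div, le_div_iff₀ hA₁]
    linarith
  have hvH : v ≤ M * HN ε U G q p := hMle _ _ (by linarith) (hv3.trans_le hV3)
  rw [← hv3]
  exact power_drift_le hv hc hC hD hM hM' hH hvH hHv hL' hΓ' m

end Powers

end RelLangevin

/-- Lemma 3.2: under Assumptions (U), (G1), (G2) and the normalization, there exists
`ε₀ ∈ (0,1)` such that for every `ε ∈ (0,ε₀)` there are `A₁, A₂, κ_N > 0` with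
`V_N ≥ 1` on `X`, and for every `n ≥ 1` there are `c_n, C_n > 0` such that
`L_N(V_Nⁿ) ≤ −c_n V_N^{n−1/3} + C_n` on `X`. -/
theorem stmt_13 (d N : ℕ) (hd : 1 ≤ d) (hN : 2 ≤ N)
    (U G : EuclideanSpace ℝ (Fin d) → ℝ)
    (a₁ lam a₂ a₃ β₁ β₂ a₄ a₅ a₆ : ℝ)
    (ha₁ : 0 < a₁) (hlam : 1 ≤ lam) (ha₂ : 0 < a₂) (ha₃ : 0 < a₃)
    (hβ₁ : 1 ≤ β₁) (hβ₂0 : 0 ≤ β₂) (hβ₂1 : β₂ < β₁) (ha₄ : 0 < a₄) (ha₆ : 0 < a₆)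
    (hUsmooth : ContDiff ℝ (⊤ : ℕ∞) U)
    (hUone : ∀ q, 1 ≤ U q)
    (hUlow : ∀ q : EuclideanSpace ℝ (Fin d), (1 / a₁) * ‖q‖ ^ (lam + 1) - a₁ ≤ U q)
    (hUup : ∀ q : EuclideanSpace ℝ (Fin d), U q ≤ a₁ * (1 + ‖q‖ ^ (lam + 1)))
    (hUgrad : ∀ q : EuclideanSpace ℝ (Fin d), ‖gradient U q‖ ≤ a₁ * (1 + ‖q‖ ^ lam))
    (hUcoer : ∀ q : EuclideanSpace ℝ (Fin d), a₂ * ‖q‖ ^ (lam + 1) - a₃ ≤ ⟪gradient U q, q⟫)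
    (hGsmooth : ContDiffOn ℝ (⊤ : ℕ∞) G {(0 : EuclideanSpace ℝ (Fin d))}ᶜ)
    (hGblow : Filter.Tendsto G (nhdsWithin 0 {(0 : EuclideanSpace ℝ (Fin d))}ᶜ) Filter.atTop)
    (hGeven : ∀ q, G (-q) = G q)
    (hGodd : ∀ q : EuclideanSpace ℝ (Fin d), q ≠ 0 → gradient G (-q) = -gradient G q)
    (hGbd : ∀ q : EuclideanSpace ℝ (Fin d), q ≠ 0 →
      |G q| ≤ a₁ * (1 + ‖q‖ + ‖q‖ ^ (-β₁)))
    (hGgradbd : ∀ q : EuclideanSpace ℝ (Fin d), q ≠ 0 →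
      ‖gradient G q‖ ≤ a₁ * (1 + ‖q‖ ^ (-β₁)))
    (hGstruct : ∀ q : EuclideanSpace ℝ (Fin d), q ≠ 0 →
      ‖gradient G q + (a₄ / ‖q‖ ^ (β₁ + 1)) • q + (a₅ / ‖q‖ ^ (β₂ + 1)) • q‖ ≤ a₆)
    (hG2a : 1 < β₁) (hG2b : β₁ ≤ 2) (hG2c : β₂ < β₁ - 1)
    (hNorm : ∀ q : Fin N → EuclideanSpace ℝ (Fin d), Function.Injective q →
      1 ≤ ∑ i, U (q i) +
          ∑ i : Fin N, ∑ j ∈ Finset.univ.filter (fun j => i < j), G (q i - q j)) :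
    ∃ ε₀ : ℝ, ε₀ ∈ Set.Ioo (0 : ℝ) 1 ∧
      ∀ ε : ℝ, ε ∈ Set.Ioo (0 : ℝ) ε₀ →
        ∃ A₁ A₂ κ : ℝ, 0 < A₁ ∧ 0 < A₂ ∧ 0 < κ ∧
          (∀ q : Fin N → EuclideanSpace ℝ (Fin d), Function.Injective q →
            ∀ p : Fin N → EuclideanSpace ℝ (Fin d), 1 ≤ VN ε β₁ A₁ A₂ κ U G q p) ∧
          (∀ n : ℕ, 1 ≤ n →
            ∃ c C : ℝ, 0 < c ∧ 0 < C ∧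
              ∀ q : Fin N → EuclideanSpace ℝ (Fin d), Function.Injective q →
                ∀ p : Fin N → EuclideanSpace ℝ (Fin d),
                  LN ε U G (fun q' p' => (VN ε β₁ A₁ A₂ κ U G q' p') ^ n) q p
                    ≤ -c * (VN ε β₁ A₁ A₂ κ U G q p) ^ ((n : ℝ) - 1 / 3) + C) := by
  have hne : IsOpen {(0 : EuclideanSpace ℝ (Fin d))}ᶜ := isOpen_compl_singleton
  have h : RelLangevin.Potentials U G a₁ lam a₂ a₃ (β₁ - 1) β₂ a₄ a₅ a₆ :=
    { a₁_pos := ha₁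
      one_le_lam := hlam
      a₂_pos := ha₂
      a₃_pos := ha₃
      s_pos := by linarith
      s_le_one := by linarith
      β₂_nonneg := hβ₂0
      β₂_le := hG2c.le
      a₄_pos := ha₄
      a₆_pos := ha₆
      U_diff := hUsmooth.differentiable (by simp)
      U_low := hUlow
      U_up := hUup
      U_grad := hUgrad
      U_coer := hUcoer
      G_diff := fun q hq =>
        (hGsmooth.differentiableOn (by simp)).differentiableAt (hne.mem_nhds hq)
      G_odd := hGodd
      G_bd := by simpa only [sub_add_cancel] using hGbd
      G_grad := by simpa only [sub_add_cancel] using hGgradbd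
      G_struct := by
        rw [show β₁ - 1 + 2 = β₁ + 1 by ring]
        exact hGstruct }
  obtain ⟨ε₀, hε₀, hmain⟩ := h.exists_lyapunov_drift hN fun q hq => by
    have := hNorm q hq
    rwa [RelLangevin.sum_lt_eq_sum_pairs (fun i j => G (q i - q j))] at this
  refine ⟨ε₀, hε₀, fun ε hε => ?_⟩
  obtain ⟨A₁, A₂, κ, hA₁, hA₂, hκ, hV, hdrift⟩ := hmain ε hε
  have e : VN (N := N) ε β₁ A₁ A₂ κ U G = RelLangevin.lyapunov ε (β₁ - 1) A₁ A₂ κ U G := by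
    funext q p
    exact RelLangevin.VN_eq ε β₁ A₁ A₂ κ U G q p
  exact ⟨A₁, A₂, κ, hA₁, hA₂, hκ, by rw [e]; exact hV, by rw [e]; exact hdrift⟩
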